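/- arXiv:0706.0201 — 2 statements merged into one kernel-verified Lean document; each statement's English description precedes it below -/
import Mathlib

section
/- Let B be a Noetherian local domain of characteristic p with perfect residue field and finite Frobenius φ, and let E = Frac(B), d = dim B. Then the pushforward φ_* : G₀(Spec E) → G₀(Spec E) on the Grothendieck group of the generic point, identified with ℤ via dimension over E, is multiplication by p^d; equivalently, B viewed as a module over itself via φ is generically free of rank p^d, i.e., dim_E (φ_* B ⊗_B E) = p^d. -/
/-- `B` viewed as a module over itself by restriction of scalars along the Frobenius
endomorphism `b ↦ b^p`. -/
def FrobeniusModule (B : Type) (p : ℕ) [CommRing B] [ExpChar B p] : Type := B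

instance (B : Type) (p : ℕ) [CommRing B] [ExpChar B p] :
    AddCommGroup (FrobeniusModule B p) := inferInstanceAs (AddCommGroup B)

instance (B : Type) (p : ℕ) [CommRing B] [ExpChar B p] :
    Module B (FrobeniusModule B p) := Module.compHom B (frobenius B p)

set_option linter.unusedSectionVars false
namespace S14
open IsLocalRing

lemma numeric (p d r t c b A C : ℕ) (hp : 2 ≤ p) (F g : ℕ → ℕ)
    (hlow : ∀ n ≥ 1, n ^ d ≤ A * F n) (hup : ∀ n ≥ 1, F n ≤ b * n ^ d)
    (hg : ∀ n ≥ 1, n * g n ≤ C * n ^ d)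
    (h1 : ∀ n, F (p * n) ≤ r * F n + t * g n)
    (h2 : ∀ n, r * F n ≤ F (p * n + c) + t * g n) : r = p ^ d := by
  obtain ⟨n0, hn0, hsmall⟩ : ∃ n0 ≥ 1, ∀ n ≥ n0, 2 * (t * g n) ≤ F n := by
    refine ⟨2 * t * C * A + 1, by omega, fun n hn => ?_⟩
    have e1 := hlow n (by omega)
    have e2 := hg n (by omega)
    have : n * (2 * (t * g n)) ≤ n * F n := by
      calc n * (2 * (t * g n)) = 2 * t * (n * g n) := by ring
        _ ≤ 2 * t * (C * (A * F n)) := Nat.mul_le_mul_left _ (e2.trans (Nat.mul_le_mul_left _ e1))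
        _ = (2 * t * C * A) * F n := by ring
        _ ≤ n * F n := Nat.mul_le_mul_right _ (by omega)
    exact Nat.le_of_mul_le_mul_left this (by omega)
  have hF0 : 0 < F n0 := by
    have := hlow n0 hn0
    have h3 : 0 < n0 ^ d := by positivity
    exact Nat.pos_of_mul_pos_left (by omega : 0 < A * F n0)
  have hP : 1 ≤ p ^ d := Nat.one_le_pow _ _ (by omega)
  -- comparison lemma
  have cmp : ∀ (u v K L : ℕ), u < v → 0 < L → (∀ k : ℕ, v ^ k * L ≤ u ^ k * K) → False := by
    intro u v K L huv hL h
    have hv : (0 : ℝ) < v := by exact_mod_cast (by omega : 0 < v)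
    have hlt : (u : ℝ) / v < 1 := by rw [div_lt_one hv]; exact_mod_cast huv
    have hlim := (tendsto_pow_atTop_nhds_zero_of_lt_one (by positivity) hlt).mul_const (K : ℝ)
    rw [zero_mul] at hlim
    have hge : ∀ k : ℕ, (L : ℝ) ≤ ((u : ℝ) / v) ^ k * K := by
      intro k
      have : (v : ℝ) ^ k * L ≤ u ^ k * K := by exact_mod_cast h k
      rw [div_pow, div_mul_eq_mul_div, le_div_iff₀ (by positivity)]
      linarith
    have := ge_of_tendsto' hlim hge
    have : (0 : ℝ) < L := by exact_mod_cast hL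
    linarith
  rcases lt_trichotomy r (p ^ d) with h | h | h
  · exfalso
    have it : ∀ k, 2 ^ k * F (p ^ k * n0) ≤ (2 * r + 1) ^ k * F n0 := by
      intro k
      induction k with
      | zero => simp
      | succ k ih =>
        have e1 := h1 (p ^ k * n0)
        have e2 := hsmall (p ^ k * n0) (Nat.le_mul_of_pos_left _ (by positivity))
        calc 2 ^ (k + 1) * F (p ^ (k + 1) * n0) = 2 ^ k * (2 * F (p * (p ^ k * n0))) := by
              rw [show p ^ (k + 1) * n0 = p * (p ^ k * n0) by ring]; ring
          _ ≤ 2 ^ k * ((2 * r + 1) * F (p ^ k * n0)) := Nat.mul_le_mul_left _ (by linarith)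
          _ = (2 * r + 1) * (2 ^ k * F (p ^ k * n0)) := by ring
          _ ≤ (2 * r + 1) * ((2 * r + 1) ^ k * F n0) := by gcongr
          _ = _ := by ring
    refine cmp (2 * r + 1) (2 * p ^ d) (A * F n0) (n0 ^ d) (by omega) (by positivity) fun k => ?_
    have e3 := hlow (p ^ k * n0) (Nat.one_le_iff_ne_zero.mpr (by positivity))
    calc (2 * p ^ d) ^ k * n0 ^ d = 2 ^ k * (p ^ k * n0) ^ d := by
          rw [mul_pow, mul_pow, ← pow_mul, ← pow_mul, mul_comm d k]; ring
      _ ≤ 2 ^ k * (A * F (p ^ k * n0)) := by gcongr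
      _ = A * (2 ^ k * F (p ^ k * n0)) := by ring
      _ ≤ A * ((2 * r + 1) ^ k * F n0) := Nat.mul_le_mul_left _ (it k)
      _ = _ := by ring
  · exact h
  · exfalso
    obtain ⟨r', rfl⟩ : ∃ r', r = r' + 1 := ⟨r - 1, by omega⟩
    have it : ∀ k, ∃ n ≥ n0, n + c ≤ p ^ k * (n0 + c) ∧ (2 * r' + 1) ^ k * F n0 ≤ 2 ^ k * F n := by
      intro k
      induction k with
      | zero => exact ⟨n0, le_rfl, by simp, by simp⟩
      | succ k ih =>
        obtain ⟨n, hn, hn2, hn3⟩ := ih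
        refine ⟨p * n + c, by nlinarith, ?_, ?_⟩
        · calc p * n + c + c ≤ p * (n + c) := by nlinarith
            _ ≤ p * (p ^ k * (n0 + c)) := by gcongr
            _ = _ := by ring
        · have e1 := h2 n
          have e2 := hsmall n hn
          calc (2 * r' + 1) ^ (k + 1) * F n0 = (2 * r' + 1) * ((2 * r' + 1) ^ k * F n0) := by ring
            _ ≤ (2 * r' + 1) * (2 ^ k * F n) := by gcongr
            _ = 2 ^ k * ((2 * r' + 1) * F n) := by ring
            _ ≤ 2 ^ k * (2 * F (p * n + c)) := Nat.mul_le_mul_left _ (by linarith)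
            _ = _ := by ring
    refine cmp (2 * p ^ d) (2 * r' + 1) (b * (n0 + c) ^ d) (F n0) (by omega) hF0 fun k => ?_
    obtain ⟨n, hn, hn2, hn3⟩ := it k
    calc _ ≤ 2 ^ k * F n := hn3
      _ ≤ 2 ^ k * (b * n ^ d) := by gcongr; exact hup n (by omega)
      _ ≤ 2 ^ k * (b * (p ^ k * (n0 + c)) ^ d) := by gcongr; omega
      _ = _ := by rw [mul_pow, mul_pow 2, ← pow_mul, ← pow_mul, mul_comm d k]; ring
section gen
variable {B : Type} [CommRing B]

/-- length of the quotient ring -/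
noncomputable abbrev L (I : Ideal B) : ℕ∞ := Module.length B (B ⧸ I)

lemma L_anti {I J : Ideal B} (h : I ≤ J) : L J ≤ L I :=
  Module.length_le_of_surjective (Submodule.factor h) (Submodule.factor_surjective h)

lemma L_colon (K : Ideal B) (x : B) :
    L K = L (Submodule.comap (LinearMap.mulLeft B x) K : Ideal B) + L (K ⊔ Ideal.span {x}) := by
  refine Module.length_eq_add_of_exact
    (Submodule.mapQ (Submodule.comap (LinearMap.mulLeft B x) K) K (LinearMap.mulLeft B x) le_rfl)
    (Submodule.factor (le_sup_left : K ≤ K ⊔ Ideal.span {x})) ?_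
    (Submodule.factor_surjective _) ?_
  · rw [← LinearMap.ker_eq_bot, Submodule.ker_mapQ]
    simp
  · intro y
    obtain ⟨y, rfl⟩ := Submodule.Quotient.mk_surjective _ y
    constructor
    · intro h
      have h : Submodule.Quotient.mk y = (0 : B ⧸ (K ⊔ Ideal.span {x})) := h
      rw [Submodule.Quotient.mk_eq_zero] at h
      obtain ⟨a, ha, b, hb, rfl⟩ := Submodule.mem_sup.mp h
      obtain ⟨c, rfl⟩ := Ideal.mem_span_singleton'.mp hb
      refine ⟨Submodule.Quotient.mk c, ?_⟩
      rw [Submodule.mapQ_apply, Submodule.Quotient.eq]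
      have : (LinearMap.mulLeft B x) c - (a + c * x) = -a := by
        simp; ring
      rw [this]
      exact K.neg_mem ha
    · rintro ⟨c, hc⟩
      obtain ⟨c, rfl⟩ := Submodule.Quotient.mk_surjective _ c
      rw [← hc, Submodule.mapQ_apply]
      change Submodule.Quotient.mk _ = (0 : B ⧸ (K ⊔ Ideal.span {x}))
      rw [Submodule.Quotient.mk_eq_zero]
      exact Ideal.mem_sup_right (Ideal.mem_span_singleton.mpr ⟨c, rfl⟩)

lemma L_mul (J : Ideal B) (x y : B) :
    L (J ⊔ Ideal.span {x * y}) ≤ L (J ⊔ Ideal.span {x}) + L (J ⊔ Ideal.span {y}) := by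
  rw [L_colon _ x, add_comm]
  gcongr
  · apply L_anti
    rw [sup_le_iff]
    exact ⟨le_sup_of_le_left le_sup_left, le_sup_right⟩
  · apply L_anti
    rw [sup_le_iff]
    constructor
    · intro j hj
      exact Ideal.mem_sup_left (J.mul_mem_left x hj)
    · rw [Ideal.span_singleton_le_iff_mem]
      exact Ideal.mem_sup_right (Ideal.mem_span_singleton_self _)

lemma L_pow (J : Ideal B) (x : B) (n : ℕ) :
    L (J ⊔ Ideal.span {x ^ n}) ≤ n * L (J ⊔ Ideal.span {x}) := by
  induction n with
  | zero => 
    have : L (J ⊔ Ideal.span {x ^ 0}) = 0 := by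
      rw [Module.length_eq_zero_iff, Submodule.Quotient.subsingleton_iff]
      simp
    exact this.le.trans zero_le
  | succ n ih =>
    rw [pow_succ]
    refine (L_mul J _ _).trans ?_
    push_cast
    rw [add_mul, one_mul]
    gcongr

lemma L_pows (s : Finset B) (n : ℕ) (J : Ideal B) :
    L (J ⊔ Ideal.span ((· ^ n) '' (s : Set B))) ≤ (n ^ s.card : ℕ) * L (J ⊔ Ideal.span s) := by
  classical
  induction s using Finset.induction_on generalizing J with
  | empty => simp
  | insert a s ha ih =>
    rw [Finset.card_insert_of_notMem ha, Finset.coe_insert, Set.image_insert_eq,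
      Ideal.span_insert, Ideal.span_insert, ← sup_assoc, ← sup_assoc]
    refine (ih _).trans ?_
    have h := L_pow (J ⊔ Ideal.span (s : Set B)) a n
    rw [sup_right_comm J, sup_right_comm J (Ideal.span (s : Set B)) (Ideal.span {a})] at h
    rw [pow_succ, Nat.cast_mul, mul_assoc]
    exact mul_le_mul_right h _

variable [IsLocalRing B] 

lemma L_max : L (maximalIdeal B) = 1 := by
  rw [Module.length_eq_one_iff]
  exact isSimpleModule_iff_isCoatom.mpr (maximalIdeal.isMaximal B).out

variable [IsNoetherianRing B]

lemma L_fin {I : Ideal B} {n : ℕ} (h : maximalIdeal B ^ n ≤ I) : L I ≠ ⊤ := by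
  obtain ⟨s, hs⟩ := (isNoetherianRing_iff_ideal_fg B).mp inferInstance (maximalIdeal B)
  have h1 := L_pows s n ⊥
  rw [bot_sup_eq, bot_sup_eq, show Ideal.span (s : Set B) = maximalIdeal B from hs, L_max, mul_one] at h1
  refine ne_top_of_le_ne_top (ENat.natCast_ne_top _) ((L_anti ?_).trans h1)
  refine le_trans (Ideal.span_le.mpr ?_) h
  rintro _ ⟨x, hx, rfl⟩
  exact Ideal.pow_mem_pow (hs ▸ Ideal.subset_span hx) n

lemma exists_sop (J : Ideal B) (hJ : J ≠ ⊤) (e : ℕ) (he : ringKrullDim (B ⧸ J) ≤ e) :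
    ∃ s : Finset B, s.card ≤ e ∧ (s : Set B) ⊆ maximalIdeal B ∧ ∃ k, maximalIdeal B ^ k ≤ J ⊔ Ideal.span s := by
  classical
  have : Nontrivial (B ⧸ J) := Ideal.Quotient.nontrivial_iff.mpr hJ
  have : IsLocalRing (B ⧸ J) := .of_surjective' (Ideal.Quotient.mk J) Ideal.Quotient.mk_surjective
  have hloc : IsLocalHom (Ideal.Quotient.mk J) := 
    IsLocalHom.of_surjective _ Ideal.Quotient.mk_surjective
  obtain ⟨s, hs, hc⟩ := Ideal.exists_finset_card_eq_height_of_isNoetherianRing (maximalIdeal (B ⧸ J))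
  rw [← maximalIdeal_height_eq_ringKrullDim, ← hc] at he
  have hrad : maximalIdeal (B ⧸ J) ≤ (Ideal.span (s : Set (B ⧸ J))).radical := by
    rw [Ideal.radical_eq_sInf]
    refine le_sInf ?_
    rintro P ⟨hP, hPp⟩
    exact hs.2 ⟨hPp, hP⟩ (le_maximalIdeal hPp.ne_top)
  obtain ⟨k, hk⟩ := Ideal.exists_pow_le_of_le_radical_of_fg hrad ((isNoetherianRing_iff_ideal_fg _).mp inferInstance _)
  obtain ⟨g, hg⟩ := (Ideal.Quotient.mk_surjective (I := J)).hasRightInverse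
  have hmap : Ideal.map (Ideal.Quotient.mk J) (Ideal.span (s.image g : Set B)) = Ideal.span s := by
    rw [Ideal.map_span, Finset.coe_image, Set.image_image]
    simp [hg _]
  refine ⟨s.image g, Finset.card_image_le.trans (by exact_mod_cast he), ?_, k, ?_⟩
  · rintro _ hx
    obtain ⟨y, hy, rfl⟩ := Finset.mem_image.mp (Finset.mem_coe.mp hx)
    have : y ∈ maximalIdeal (B ⧸ J) := hs.1.2 (Ideal.subset_span hy)
    rw [SetLike.mem_coe, mem_maximalIdeal, mem_nonunits_iff]
    intro h
    have h2 := h.map (Ideal.Quotient.mk J)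
    rw [hg] at h2
    exact this h2
  · have : maximalIdeal B ^ k ≤ Ideal.comap (Ideal.Quotient.mk J) (Ideal.map (Ideal.Quotient.mk J) (Ideal.span (s.image g : Set B))) := by
      rw [hmap, ← Ideal.map_le_iff_le_comap, Ideal.map_pow]
      refine le_trans (Ideal.pow_right_mono ?_ k) hk
      exact ((local_hom_TFAE (Ideal.Quotient.mk J)).out 0 2).mp hloc
    rw [Ideal.comap_map_of_surjective _ Ideal.Quotient.mk_surjective, ← RingHom.ker_eq_comap_bot, Ideal.mk_ker, sup_comm] at this
    exact this

lemma upper (J : Ideal B) (hJ : J ≠ ⊤) (e : ℕ) (he : ringKrullDim (B ⧸ J) ≤ e) :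
    ∃ C : ℕ, ∀ n ≥ 1, L (J ⊔ maximalIdeal B ^ n) ≤ (C * n ^ e : ℕ) := by
  obtain ⟨s, hs, hm, k, hk⟩ := exists_sop J hJ e he
  have hfin := L_fin hk
  obtain ⟨C, hC⟩ := ENat.ne_top_iff_exists.mp hfin
  refine ⟨C, fun n hn => ?_⟩
  refine ((L_anti ?_).trans (L_pows s n J)).trans ?_
  · gcongr
    rw [Ideal.span_le]
    rintro _ ⟨x, hx, rfl⟩
    exact Ideal.pow_mem_pow (hm hx) n
  · rw [← hC, mul_comm]
    norm_cast
    gcongr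

lemma artin (P : Ideal B) [hP : P.IsPrime] (x : B) (hx : x ∉ P) :
    ∃ c : ℕ, ∀ n ≥ c, (Submodule.comap (LinearMap.mulLeft B x) (P ⊔ maximalIdeal B ^ n) : Ideal B) ≤ P ⊔ maximalIdeal B ^ (n - c) := by
  obtain ⟨c, hc⟩ := Ideal.exists_pow_inf_eq_pow_smul (M := B ⧸ P) (maximalIdeal B) (Submodule.span B {Ideal.Quotient.mk P x})
  have key (n : ℕ) (b : B) : Ideal.Quotient.mk P b ∈ (maximalIdeal B ^ n • ⊤ : Submodule B (B ⧸ P)) ↔ b ∈ P ⊔ maximalIdeal B ^ n := by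
    have : (maximalIdeal B ^ n • ⊤ : Submodule B (B ⧸ P)) = Submodule.map P.mkQ (maximalIdeal B ^ n) := by
      conv_rhs => rw [← mul_one (maximalIdeal B ^ n), ← smul_eq_mul, Submodule.map_smul'', Ideal.one_eq_top, Submodule.map_top, Submodule.range_mkQ]
    rw [this, ← Submodule.comap_map_mkQ, Submodule.mem_comap]
    rfl
  refine ⟨c, fun n hn b hb => ?_⟩
  have hb' : x * b ∈ P ⊔ maximalIdeal B ^ n := hb
  rw [← key] at hb'
  have h2 : Ideal.Quotient.mk P (x * b) ∈ (maximalIdeal B ^ n • ⊤ ⊓ Submodule.span B {Ideal.Quotient.mk P x} : Submodule B (B ⧸ P)) := by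
    refine ⟨hb', Submodule.mem_span_singleton.mpr ⟨b, ?_⟩⟩
    rw [mul_comm, map_mul]
    rfl
  rw [hc n hn] at h2
  have h3 := (smul_mono_right (maximalIdeal B ^ (n - c)) (inf_le_right : maximalIdeal B ^ c • ⊤ ⊓ Submodule.span B {Ideal.Quotient.mk P x} ≤ _)) h2
  rw [Submodule.mem_smul_span_singleton] at h3
  obtain ⟨y, hy, h⟩ := h3
  have h : Ideal.Quotient.mk P (y * x) = Ideal.Quotient.mk P (x * b) := by
    rw [← h, map_mul]; rfl
  rw [Ideal.Quotient.eq, mul_comm y, ← mul_sub] at h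
  have h4 := (hP.mem_or_mem h).resolve_left hx
  have : b = -(y - b) + y := by ring
  rw [this]
  exact add_mem (Ideal.mem_sup_left (neg_mem h4)) (Ideal.mem_sup_right hy)


lemma nat_pow_aux (m c d : ℕ) : (m + c) ^ (d + 1) ≤ m ^ (d + 1) + c * (d + 1) * (m + c) ^ d := by
  induction d with
  | zero => simp
  | succ d ih =>
    have h1 : m ^ (d + 1) ≤ (m + c) ^ (d + 1) := by gcongr; omega
    calc (m + c) ^ (d + 1 + 1) = (m + c) * (m + c) ^ (d + 1) := by ring
      _ ≤ (m + c) * (m ^ (d + 1) + c * (d + 1) * (m + c) ^ d) := by gcongr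
      _ = m ^ (d + 1 + 1) + c * m ^ (d + 1) + c * (d + 1) * (m + c) ^ (d + 1) := by ring
      _ ≤ m ^ (d + 1 + 1) + c * (m + c) ^ (d + 1) + c * (d + 1) * (m + c) ^ (d + 1) := by gcongr
      _ = _ := by ring

/-- nat valued length -/
noncomputable def f (P : Ideal B) (n : ℕ) : ℕ := (L (P ⊔ maximalIdeal B ^ n)).toNat

lemma coe_f (P : Ideal B) (n : ℕ) : (f P n : ℕ∞) = L (P ⊔ maximalIdeal B ^ n) :=
  ENat.natCast_toNat (L_fin (n := n) le_sup_right)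

lemma one_le_f {P : Ideal B} (hP : P ≠ ⊤) {n : ℕ} (hn : 1 ≤ n) : 1 ≤ f P n := by
  have : (1 : ℕ∞) ≤ f P n := by
    rw [coe_f, ← L_max (B := B)]
    apply L_anti
    rw [sup_le_iff]
    exact ⟨le_maximalIdeal hP, Ideal.pow_le_self (by omega)⟩
  exact_mod_cast this

lemma lower (d : ℕ) (P : PrimeSpectrum B) (h : (d : ℕ∞) ≤ Order.coheight P) :
    ∃ A : ℕ, ∀ n ≥ 1, n ^ d ≤ A * f P.asIdeal n := by
  induction d generalizing P with
  | zero =>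
    refine ⟨1, fun n hn => ?_⟩
    have := one_le_f P.isPrime.ne_top hn
    simpa using this
  | succ d ih =>
    have h' : (d : ℕ∞) < Order.coheight P := lt_of_lt_of_le (by exact_mod_cast Nat.lt_succ_self d) h
    obtain ⟨Q, hPQ, hQ⟩ : ∃ Q, P < Q ∧ (d : ℕ∞) ≤ Order.coheight Q := by
      by_contra! hcon
      exact absurd (Order.coheight_le_coe_iff.mpr hcon) (not_le.mpr h')
    obtain ⟨A, hA⟩ := ih Q hQ
    obtain ⟨x, hxQ, hxP⟩ := SetLike.exists_of_lt (show P.asIdeal < Q.asIdeal from hPQ)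
    obtain ⟨c, hc⟩ := artin P.asIdeal x hxP
    have step : ∀ n ≥ c + 1, f P.asIdeal (n - (c + 1)) + f Q.asIdeal n ≤ f P.asIdeal n := by
      intro n hn
      have : (f P.asIdeal (n - (c + 1)) : ℕ∞) + f Q.asIdeal n ≤ f P.asIdeal n := by
        rw [coe_f, coe_f, coe_f, L_colon (P.asIdeal ⊔ maximalIdeal B ^ n) x]
        refine add_le_add (L_anti ?_) (L_anti ?_)
        · refine (hc n (by omega)).trans ?_
          exact sup_le_sup_left (Ideal.pow_le_pow_right (by omega)) _
        · rw [sup_le_iff, sup_le_iff]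
          refine ⟨⟨le_sup_of_le_left hPQ.le, le_sup_right⟩, le_sup_of_le_left ?_⟩
          rwa [Ideal.span_singleton_le_iff_mem]
      exact_mod_cast this
    refine ⟨(c + 1) * (d + 1) * A + (c + 1) ^ (d + 1), fun n hn => ?_⟩
    induction n using Nat.strong_induction_on with
    | _ n ihn =>
      rcases lt_or_ge n (c + 1) with h1 | h1
      · have := one_le_f P.isPrime.ne_top hn
        calc n ^ (d + 1) ≤ (c + 1) ^ (d + 1) := by gcongr
          _ ≤ ((c + 1) * (d + 1) * A + (c + 1) ^ (d + 1)) := by omega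
          _ ≤ _ := Nat.le_mul_of_pos_right _ this
      · obtain ⟨m, rfl⟩ := Nat.exists_eq_add_of_le' h1
        have hs := step _ h1
        rw [Nat.add_sub_cancel] at hs
        have hm : m ^ (d + 1) ≤ ((c + 1) * (d + 1) * A + (c + 1) ^ (d + 1)) * f P.asIdeal m := by
          rcases Nat.eq_zero_or_pos m with rfl | hm
          · simp
          · exact ihn m (by omega) hm
        have hq := hA (m + (c + 1)) hn
        calc _ ≤ _ := nat_pow_aux m (c + 1) d
          _ ≤ ((c + 1) * (d + 1) * A + (c + 1) ^ (d + 1)) * f P.asIdeal m + (c + 1) * (d + 1) * (A * f Q.asIdeal (m + (c + 1))) := by gcongr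
          _ ≤ ((c + 1) * (d + 1) * A + (c + 1) ^ (d + 1)) * (f P.asIdeal m + f Q.asIdeal (m + (c + 1))) := by nlinarith [Nat.zero_le ((c + 1) ^ (d + 1) * f Q.asIdeal (m + (c + 1)))]
          _ ≤ _ := by gcongr

lemma pow_le_frob (p : ℕ) (hp : 1 ≤ p) (I : Ideal B) : ∃ c : ℕ, ∀ n, ∀ Q : Ideal B, 
    (∀ x ∈ I, x ^ p ∈ Q) → I ^ (p * n + c) ≤ Q ^ n := by
  classical
  obtain ⟨s, hs⟩ := (isNoetherianRing_iff_ideal_fg B).mp inferInstance I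
  have hI : I = ∑ i ∈ s, Ideal.span {i} := by
    rw [← hs, Ideal.sum_eq_sup, Finset.sup_eq_iSup]
    exact le_antisymm (Ideal.span_le.mpr fun i hi => (le_iSup₂ (f := fun i (_ : i ∈ s) => Ideal.span {i}) i hi) (Ideal.mem_span_singleton_self i)) (iSup₂_le fun i hi => Ideal.span_mono (by simpa using hi))
  refine ⟨p * s.card, fun n Q hQ => ?_⟩
  have key : ∀ N ≥ p * s.card, I ^ (N + p) ≤ Q * I ^ N := by
    intro N hN
    conv_lhs => rw [hI, Finset.sum_pow_eq_sum_piAntidiag]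
    rw [Ideal.sum_eq_sup]
    refine Finset.sup_le fun k hk => ?_
    refine Ideal.mul_le_right.trans ?_
    rw [Finset.mem_piAntidiag] at hk
    obtain ⟨i, hi, hik⟩ : ∃ i ∈ s, p ≤ k i := by
      by_contra! hcon
      have : ∑ i ∈ s, k i ≤ ∑ i ∈ s, p := Finset.sum_le_sum fun i hi => (hcon i hi).le
      rw [Finset.sum_const, smul_eq_mul, mul_comm] at this
      have h2 : ∑ i ∈ s, k i = N + p := hk.1
      omega
    rw [← Finset.mul_prod_erase s _ hi]
    obtain ⟨t, ht⟩ := Nat.exists_eq_add_of_le hik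
    rw [ht, pow_add, mul_assoc]
    refine Ideal.mul_mono ?_ ?_
    · rw [Ideal.span_singleton_pow, Ideal.span_singleton_le_iff_mem]
      exact hQ _ (hs ▸ Ideal.subset_span hi)
    · have hsp : ∀ j ∈ s, Ideal.span {j} ≤ I := fun j hj => by
        rw [Ideal.span_singleton_le_iff_mem]
        exact (hs ▸ Ideal.subset_span hj)
      have hN : N = t + ∑ j ∈ s.erase i, k j := by
        have : ∑ i ∈ s, k i = N + p := hk.1
        rw [← Finset.add_sum_erase s _ hi] at this
        omega
      rw [hN, pow_add, ← Finset.prod_pow_eq_pow_sum]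
      refine Ideal.mul_mono (Ideal.pow_right_mono (hsp i hi) _) ?_
      refine Finset.prod_le_prod' fun j hj => Ideal.pow_right_mono (hsp j (Finset.mem_of_mem_erase hj)) _
  have key2 : ∀ n, I ^ (p * n + p * s.card) ≤ Q ^ n * I ^ (p * s.card) := by
    intro n
    induction n with
    | zero => simp
    | succ n ih =>
      rw [show p * (n + 1) + p * s.card = (p * n + p * s.card) + p by ring]
      refine (key _ (by omega)).trans ?_
      rw [pow_succ', mul_assoc]
      exact Ideal.mul_mono_right ih
  exact (key2 n).trans Ideal.mul_le_left


section mod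
variable {N M W : Type} [AddCommGroup N] [Module B N] [AddCommGroup M] [Module B M]
  [AddCommGroup W] [Module B W]

lemma gen_bound (I : Ideal B) (t : ℕ) (w : Fin t → W) (hw : Submodule.span B (Set.range w) = ⊤)
    (hI : ∀ a ∈ I, ∀ y : W, a • y = 0) : Module.length B W ≤ t * L I := by
  let g : Fin t → ((B ⧸ I) →ₗ[B] W) := fun i =>
    Submodule.liftQ I (LinearMap.toSpanSingleton B W (w i)) (fun a ha => by
      simpa using hI a ha (w i))
  let G : (Fin t → (B ⧸ I)) →ₗ[B] W := ∑ i, (g i).comp (LinearMap.proj i)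
  have hG : Function.Surjective G := by
    rw [← LinearMap.range_eq_top, eq_top_iff, ← hw, Submodule.span_le]
    rintro _ ⟨i, rfl⟩
    refine ⟨Pi.single i (Submodule.Quotient.mk 1), ?_⟩
    simp only [G, LinearMap.sum_apply, LinearMap.comp_apply, LinearMap.proj_apply]
    rw [Finset.sum_eq_single i]
    · rw [Pi.single_eq_same]
      change LinearMap.toSpanSingleton B W (w i) 1 = w i
      simp
    · intro j _ hj
      rw [Pi.single_eq_of_ne hj, map_zero]
    · simp
  have := Module.length_le_of_surjective G hG
  rw [Module.length_pi] at this
  simpa using this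

/-- length of M/m^n M -/
noncomputable abbrev G (B : Type) [CommRing B] [IsLocalRing B] (M : Type) [AddCommGroup M] [Module B M] (n : ℕ) : ℕ∞ :=
  Module.length B (M ⧸ (maximalIdeal B ^ n • ⊤ : Submodule B M))

lemma mod_bound (h : N →ₗ[B] M) (t : ℕ) (w : Fin t → M) (hw : Submodule.span B (Set.range w) = ⊤)
    (x : B) (hx : ∀ y : M, x • y ∈ LinearMap.range h) (n : ℕ) :
    G B M n ≤ G B N n + t * L (Ideal.span {x} ⊔ maximalIdeal B ^ n) := by
  let q := Submodule.mapQ (maximalIdeal B ^ n • ⊤ : Submodule B N) (maximalIdeal B ^ n • ⊤ : Submodule B M) h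
    (by rw [← Submodule.map_le_iff_le_comap, Submodule.map_smul'']; exact smul_mono_right _ le_top)
  have h1 := Module.length_eq_add_of_exact (LinearMap.range q).subtype (LinearMap.range q).mkQ
    (Submodule.subtype_injective _) (Submodule.mkQ_surjective _) (LinearMap.exact_subtype_mkQ _)
  unfold G
  rw [h1]
  refine add_le_add (Module.length_le_of_surjective q.rangeRestrict q.surjective_rangeRestrict) ?_
  let π : M →ₗ[B] (_ ⧸ (LinearMap.range q)) := (LinearMap.range q).mkQ.comp (Submodule.mkQ _)
  have hπ : Function.Surjective π := (Submodule.mkQ_surjective _).comp (Submodule.mkQ_surjective _)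
  refine gen_bound _ t (fun i => π (w i)) ?_ ?_
  · rw [show Set.range (fun i => π (w i)) = π '' Set.range w from Set.range_comp _ _,
      ← Submodule.map_span, hw, Submodule.map_top, LinearMap.range_eq_top.mpr hπ]
  · intro a ha y
    obtain ⟨y, rfl⟩ := hπ y
    obtain ⟨b, hb, c, hc, rfl⟩ := Submodule.mem_sup.mp ha
    obtain ⟨b, rfl⟩ := Ideal.mem_span_singleton'.mp hb
    have h1 : π (c • y) = 0 := by
      have : Submodule.mkQ (maximalIdeal B ^ n • ⊤ : Submodule B M) (c • y) = 0 := by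
        rw [← LinearMap.mem_ker, Submodule.ker_mkQ]
        exact Submodule.smul_mem_smul hc trivial
      rw [LinearMap.comp_apply, this, map_zero]
    have h2 : π (x • y) = 0 := by
      obtain ⟨z, hz⟩ := hx y
      rw [← hz, LinearMap.comp_apply, ← LinearMap.mem_ker, Submodule.ker_mkQ]
      exact ⟨Submodule.Quotient.mk z, rfl⟩
    rw [add_smul, mul_smul, ← map_smul π x, h2, ← map_smul π c, h1, smul_zero, zero_add]

lemma span_single (r : ℕ) : Submodule.span B (Set.range (fun i : Fin r => (Pi.single i 1 : Fin r → B))) = ⊤ := by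
  have := (Pi.basisFun B (Fin r)).span_eq
  convert this
  simp

lemma free_le (r n : ℕ) : G B (Fin r → B) n ≤ r * L (maximalIdeal B ^ n) := by
  refine gen_bound _ r (fun i => Submodule.mkQ _ (Pi.single i 1)) ?_ ?_
  · rw [show (Set.range fun i => Submodule.mkQ (maximalIdeal B ^ n • ⊤ : Submodule B (Fin r → B)) (Pi.single i 1)) = Submodule.mkQ _ '' Set.range (fun i : Fin r => (Pi.single i 1 : Fin r → B)) from Set.range_comp _ _,
      ← Submodule.map_span, span_single, Submodule.map_top, Submodule.range_mkQ]
  · intro a ha y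
    obtain ⟨y, rfl⟩ := Submodule.mkQ_surjective _ y
    rw [← map_smul, ← LinearMap.mem_ker, Submodule.ker_mkQ]
    exact Submodule.smul_mem_smul ha trivial

lemma le_free (r n : ℕ) : r * L (maximalIdeal B ^ n) ≤ G B (Fin r → B) n := by
  let q : (Fin r → B) →ₗ[B] (Fin r → B ⧸ (maximalIdeal B ^ n)) :=
    LinearMap.pi fun i => (Submodule.mkQ (maximalIdeal B ^ n)).comp (LinearMap.proj i)
  have hq : Function.Surjective q := by
    intro y
    choose z hz using fun i => Submodule.mkQ_surjective (maximalIdeal B ^ n) (y i)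
    exact ⟨z, funext hz⟩
  have hk : (maximalIdeal B ^ n • ⊤ : Submodule B (Fin r → B)) ≤ LinearMap.ker q := by
    rw [Submodule.smul_le]
    intro a ha y _
    rw [LinearMap.mem_ker]
    ext i
    change Submodule.Quotient.mk (a * y i) = (0 : B ⧸ (maximalIdeal B ^ n))
    rw [Submodule.Quotient.mk_eq_zero]
    exact Ideal.mul_mem_right _ _ ha
  have := Module.length_le_of_surjective (Submodule.liftQ _ q hk) (fun y => by
    obtain ⟨z, rfl⟩ := hq y
    exact ⟨Submodule.Quotient.mk z, rfl⟩)
  rw [Module.length_pi] at this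
  simpa using this

lemma rank_bound [IsDomain B] [Module.Finite B M] : ∃ x : B, x ≠ 0 ∧ ∃ t : ℕ, ∀ n : ℕ,
    G B M n ≤ Module.finrank B M * L (maximalIdeal B ^ n) + t * L (Ideal.span {x} ⊔ maximalIdeal B ^ n) ∧
    Module.finrank B M * L (maximalIdeal B ^ n) ≤ G B M n + t * L (Ideal.span {x} ⊔ maximalIdeal B ^ n) := by
  obtain ⟨r, hr⟩ : ∃ r, r = Module.finrank B M := ⟨_, rfl⟩
  rw [← hr]
  obtain ⟨v, hv⟩ := exists_linearIndependent_of_le_finrank (R := B) (M := M) hr.le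
  let S := Submodule.span B (Set.range v)
  have hS : Module.finrank B S = r := by
    exact (finrank_span_eq_card hv).trans (by simp)
  have htor : Module.IsTorsion B (M ⧸ S) := by
    rw [← Module.finrank_eq_zero_iff_isTorsion]
    have := Submodule.finrank_quotient_add_finrank S
    omega
  obtain ⟨x, hx1, hx2⟩ := Submodule.annihilator_top_inter_nonZeroDivisors htor
  have hx0 : x ≠ 0 := nonZeroDivisors.ne_zero hx2
  have hxS : ∀ y : M, x • y ∈ S := by
    intro y
    have := Submodule.mem_annihilator.mp hx1 (Submodule.Quotient.mk y) trivial
    rwa [← Submodule.Quotient.mk_smul, Submodule.Quotient.mk_eq_zero] at this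
  let h : (Fin r → B) →ₗ[B] M := Fintype.linearCombination B v
  have hinj : Function.Injective h := hv.fintypeLinearCombination_injective
  have hrange : LinearMap.range h = S := Fintype.range_linearCombination B v
  let k : M →ₗ[B] (Fin r → B) := (LinearEquiv.ofInjective h hinj).symm.toLinearMap.comp
    (LinearMap.codRestrict (LinearMap.range h) (x • LinearMap.id) (fun y => by rw [hrange]; exact hxS y))
  have hk : ∀ y, h (k y) = x • y := fun y => by
    have := (LinearEquiv.ofInjective h hinj).apply_symm_apply (LinearMap.codRestrict (LinearMap.range h) (x • LinearMap.id) (fun y => by rw [hrange]; exact hxS y) y)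
    exact congrArg Subtype.val this
  obtain ⟨t, w, hw⟩ := Module.Finite.exists_fin (R := B) (M := M)
  refine ⟨x, hx0, t + r, fun n => ⟨?_, ?_⟩⟩
  · refine (mod_bound h t w hw x (fun y => by rw [hrange]; exact hxS y) n).trans ?_
    refine add_le_add (free_le r n) ?_
    gcongr
    exact_mod_cast Nat.le_add_right t r
  · refine (le_free r n).trans ?_
    refine (mod_bound k r _ (span_single r) x (fun y => ⟨h y, hinj ?_⟩) n).trans ?_
    · rw [hk, map_smul]
    gcongr
    exact_mod_cast Nat.le_add_left r t

end mod


end gen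

section frob
variable (B : Type) [CommRing B] [IsLocalRing B] (p : ℕ) [ExpChar B p]

@[reducible] noncomputable def instCR : CommRing (FrobeniusModule B p) := inferInstanceAs (CommRing B)

attribute [local instance] instCR

@[reducible] noncomputable def instAlg : Algebra B (FrobeniusModule B p) :=
  Algebra.ofModule (fun r x y => by
    change (frobenius B p r * (show B from x)) * (show B from y) = frobenius B p r * ((show B from x) * (show B from y))
    ring) (fun r x y => by
    change (show B from x) * (frobenius B p r * (show B from y)) = frobenius B p r * ((show B from x) * (show B from y))
    ring)

attribute [local instance] instAlg

lemma algMap_eq (b : B) : algebraMap B (FrobeniusModule B p) b = (show FrobeniusModule B p from b ^ p) := by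
  rw [Algebra.algebraMap_eq_smul_one]
  change frobenius B p b * 1 = b ^ p
  rw [mul_one, frobenius_def]

lemma instLoc : IsLocalRing (FrobeniusModule B p) := inferInstanceAs (IsLocalRing B)

attribute [local instance] instLoc

lemma algMap_hom : algebraMap B (FrobeniusModule B p) = (frobenius B p : B →+* B) := by
  ext b
  exact algMap_eq B p b

lemma finite_frob_aux (h : (frobenius B p).Finite) : Module.Finite B (FrobeniusModule B p) := by
  have : (algebraMap B (FrobeniusModule B p)).Finite := by
    rw [algMap_hom]; exact h
  exact RingHom.finite_algebraMap.mp this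

lemma G_frob_aux (hp : p ≠ 0) (hperf : Function.Surjective (fun x : IsLocalRing.ResidueField B => x ^ p)) (n : ℕ) :
    G B (FrobeniusModule B p) n = L ((maximalIdeal B ^ n).map (frobenius B p)) := by
  have hloc : IsLocalHom (algebraMap B (FrobeniusModule B p)) := ⟨fun b hb => by
    rw [algMap_eq] at hb
    have hb : IsUnit (b ^ p) := hb
    exact (isUnit_pow_iff hp).mp hb⟩
  have hsurj : Function.Surjective (algebraMap (ResidueField B) (ResidueField (FrobeniusModule B p))) := by
    intro y
    obtain ⟨y, rfl⟩ := residue_surjective y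
    obtain ⟨x, hx⟩ := hperf (residue B y)
    obtain ⟨b, rfl⟩ := residue_surjective x
    refine ⟨residue B b, ?_⟩
    rw [← ResidueField.algebraMap_eq, ← IsScalarTower.algebraMap_apply,
      IsScalarTower.algebraMap_apply B (FrobeniusModule B p), algMap_eq]
    have hx : residue B b ^ p = residue B (show B from y) := hx
    rw [← map_pow] at hx
    exact hx
  have h1 : Module.length (ResidueField B) (ResidueField (FrobeniusModule B p)) = 1 := by
    rw [Module.length_eq_of_surjective hsurj]
    simp
  have h2 := IsLocalRing.length_restrictScalars B (FrobeniusModule B p)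
    (FrobeniusModule B p ⧸ ((maximalIdeal B ^ n).map (algebraMap B (FrobeniusModule B p))))
  rw [h1, mul_one] at h2
  have h3 : Module.length (FrobeniusModule B p) (FrobeniusModule B p ⧸ ((maximalIdeal B ^ n).map (algebraMap B (FrobeniusModule B p)))) = L ((maximalIdeal B ^ n).map (frobenius B p)) := by
    rw [algMap_hom]
    rfl
  rw [← h3, ← h2]
  unfold G
  exact ((Submodule.quotEquivOfEq _ _ (Ideal.smul_top_eq_map (S := FrobeniusModule B p)
    (maximalIdeal B ^ n))).trans (Submodule.Quotient.restrictScalarsEquiv B _)).length_eq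

end frob

lemma finite_frob (B : Type) [CommRing B] [IsLocalRing B] (p : ℕ) [ExpChar B p]
    (h : (frobenius B p).Finite) : Module.Finite B (FrobeniusModule B p) :=
  finite_frob_aux B p h

lemma G_frob (B : Type) [CommRing B] [IsLocalRing B] (p : ℕ) [ExpChar B p]
    (hp : p ≠ 0) (hperf : Function.Surjective (fun x : IsLocalRing.ResidueField B => x ^ p)) (n : ℕ) :
    G B (FrobeniusModule B p) n = L ((maximalIdeal B ^ n).map (frobenius B p)) :=
  G_frob_aux B p hp hperf n

lemma main (B : Type) [CommRing B] [IsNoetherianRing B] [IsLocalRing B] [IsDomain B]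
    (p : ℕ) [hpp : Fact p.Prime] [CharP B p]
    (hperf : Function.Surjective (fun x : IsLocalRing.ResidueField B => x ^ p))
    (hfrob : (frobenius B p).Finite)
    (d : ℕ) (hd : ringKrullDim B = d) : Module.finrank B (FrobeniusModule B p) = p ^ d := by
  have hp := hpp.out
  have := finite_frob B p hfrob
  obtain ⟨x, hx, t, ht⟩ := rank_bound (B := B) (M := FrobeniusModule B p)
  obtain ⟨c, hc⟩ := pow_le_frob p hp.one_le (maximalIdeal B)
  have hbot (n : ℕ) : (f (⊥ : Ideal B) n : ℕ∞) = L (maximalIdeal B ^ n) := by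
    rw [coe_f, bot_sup_eq]
  obtain ⟨A, hA⟩ := lower d (⊥ : PrimeSpectrum B) (by
    have : ringKrullDim B = Order.coheight (⊥ : PrimeSpectrum B) := by
      rw [Order.coheight_bot_eq_krullDim]; rfl
    rw [hd] at this
    have h2 : (d : ℕ∞) = Order.coheight (⊥ : PrimeSpectrum B) := by exact_mod_cast this
    exact h2.le)
  obtain ⟨b, hb⟩ := upper (⊥ : Ideal B) bot_ne_top d (by
    rw [ringKrullDim_eq_of_ringEquiv (RingEquiv.quotientBot B), hd])
  obtain ⟨C, hC⟩ : ∃ C : ℕ, ∀ n ≥ 1, n * f (Ideal.span {x}) n ≤ C * n ^ d := by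
    by_cases hu : Ideal.span {x} = ⊤
    · refine ⟨0, fun n _ => ?_⟩
      have : f (Ideal.span {x}) n = 0 := by
        unfold f
        have : L (Ideal.span {x} ⊔ maximalIdeal B ^ n) = 0 := by
          rw [Module.length_eq_zero_iff, Submodule.Quotient.subsingleton_iff, hu, top_sup_eq]
        rw [this]; rfl
      simp [this]
    · have h1 := ringKrullDim_quotient_succ_le_of_nonZeroDivisor (mem_nonZeroDivisors_of_ne_zero hx)
      rw [hd] at h1
      have : Nontrivial (B ⧸ Ideal.span {x}) := Ideal.Quotient.nontrivial_iff.mpr hu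
      have h0 : (0 : WithBot ℕ∞) ≤ ringKrullDim (B ⧸ Ideal.span {x}) := ringKrullDim_nonneg_of_nontrivial
      obtain ⟨e, rfl⟩ : ∃ e, d = e + 1 := by
        refine ⟨d - 1, ?_⟩
        have : (1 : WithBot ℕ∞) ≤ d := le_trans (by simpa using add_le_add_left h0 1) h1
        have : 1 ≤ d := by exact_mod_cast this
        omega
      have h2 : ringKrullDim (B ⧸ Ideal.span {x}) ≤ e := by
        push_cast at h1
        revert h1
        generalize ringKrullDim (B ⧸ Ideal.span {x}) = k
        intro h1
        cases k with
        | bot => exact bot_le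
        | coe k =>
          have h1 : k + 1 ≤ (e : ℕ∞) + 1 := by exact_mod_cast h1
          have : k ≤ (e : ℕ∞) := (ENat.add_le_add_iff_right (by simp)).mp h1
          exact_mod_cast this
      obtain ⟨C, hC⟩ := upper (Ideal.span {x}) hu e h2
      refine ⟨C, fun n hn => ?_⟩
      have := hC n hn
      rw [← coe_f] at this
      have : f (Ideal.span {x}) n ≤ C * n ^ e := by exact_mod_cast this
      calc _ ≤ n * (C * n ^ e) := Nat.mul_le_mul_left _ this
        _ = _ := by ring
  refine numeric p d _ t c b A C hp.two_le (f (⊥ : Ideal B)) (f (Ideal.span {x})) hA ?_ hC ?_ ?_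
  · intro n hn
    have := hb n hn
    rw [← coe_f] at this
    exact_mod_cast this
  · intro n
    have h1 := (ht n).1
    rw [G_frob B p hp.ne_zero hperf, ← hbot, ← coe_f] at h1
    have h2 : (f (⊥ : Ideal B) (p * n) : ℕ∞) ≤ L ((maximalIdeal B ^ n).map (frobenius B p)) := by
      rw [hbot]
      apply L_anti
      rw [Ideal.map_le_iff_le_comap]
      intro y hy
      rw [Ideal.mem_comap, frobenius_def, mul_comm, pow_mul]
      exact Ideal.pow_mem_pow hy p
    exact_mod_cast h2.trans h1
  · intro n
    have h1 := (ht n).2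
    rw [G_frob B p hp.ne_zero hperf, ← hbot, ← coe_f] at h1
    have h2 : L ((maximalIdeal B ^ n).map (frobenius B p)) ≤ (f (⊥ : Ideal B) (p * n + c) : ℕ∞) := by
      rw [hbot]
      apply L_anti
      rw [Ideal.map_pow]
      exact hc n _ (fun y hy => Ideal.mem_map_of_mem (frobenius B p) hy)
    exact_mod_cast h1.trans (add_le_add_left h2 _)

end S14

/-- Let `B` be a Noetherian local domain of prime characteristic `p` and dimension `d`,
with perfect residue field and finite Frobenius `φ`, and let `E = Frac(B)`.  Then `φ_* B`
is generically free of rank `p^d`:  `dim_E (E ⊗_B φ_* B) = p^d`.  (Equivalently, the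
pushforward `φ_*` on `G₀(Spec E) ≅ ℤ` is multiplication by `p^d`.) -/
theorem stmt_14 (B : Type) [CommRing B] [IsNoetherianRing B] [IsLocalRing B] [IsDomain B]
    (p : ℕ) [Fact p.Prime] [CharP B p]
    (hperf : Function.Surjective (fun x : IsLocalRing.ResidueField B => x ^ p))
    (hfrob : (frobenius B p).Finite)
    (d : ℕ) (hd : ringKrullDim B = d) :
    Module.finrank (FractionRing B)
      (TensorProduct B (FractionRing B) (FrobeniusModule B p)) = p ^ d := by
  rw [← S14.main B p hperf hfrob d hd]
  have h1 := IsLocalizedModule.finrank_eq (nonZeroDivisors B)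
    (TensorProduct.mk B (FractionRing B) (FrobeniusModule B p) 1) le_rfl
  rw [← h1]
  have h2 := IsLocalization.rank_eq (FractionRing B) (nonZeroDivisors B) le_rfl
    (N := TensorProduct B (FractionRing B) (FrobeniusModule B p))
  unfold Module.finrank
  rw [h2]
end

section
/- Let B be a Noetherian local ring of characteristic p, dimension d, with perfect residue field and finite Frobenius φ. Then the induced endomorphism φ_* of G₀(B) ⊗ ℚ (pushforward by restriction of scalars along Frobenius) is diagonalizable with all eigenvalues contained in {1, p, p², …, p^d}. -/
/-- A bundled finitely generated module over `B`. -/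
structure FGMod (B : Type) [CommRing B] : Type 1 where
  carrier : Type
  [isAddCommGroup : AddCommGroup carrier]
  [isModule : Module B carrier]
  [isFinite : Module.Finite B carrier]

attribute [instance] FGMod.isAddCommGroup FGMod.isModule FGMod.isFinite

/-- Relations from short exact sequences of finitely generated modules. -/
def G0Relations (B : Type) [CommRing B] : AddSubgroup (FreeAbelianGroup (FGMod B)) :=
  AddSubgroup.closure
    {x | ∃ (M' M M'' : FGMod B) (f : M'.carrier →ₗ[B] M.carrier)
        (g : M.carrier →ₗ[B] M''.carrier),
      Function.Injective f ∧ Function.Surjective g ∧ LinearMap.range f = LinearMap.ker g ∧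
      x = FreeAbelianGroup.of M - FreeAbelianGroup.of M' - FreeAbelianGroup.of M''}

/-- The Grothendieck group `G₀(B)` of finitely generated `B`-modules. -/
def G0 (B : Type) [CommRing B] : Type 1 :=
  FreeAbelianGroup (FGMod B) ⧸ G0Relations B

instance (B : Type) [CommRing B] : AddCommGroup (G0 B) :=
  QuotientAddGroup.Quotient.addCommGroup _

/-- The class `[M]` of a finitely generated module in `G₀(B)`. -/
def G0.cls {B : Type} [CommRing B] (M : FGMod B) : G0 B :=
  QuotientAddGroup.mk (FreeAbelianGroup.of M)

/-- Frobenius pushforward type synonym. -/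
def Fr (_p : ℕ) (M : Type) : Type := M

namespace Fr

instance (p : ℕ) (M : Type) [AddCommGroup M] : AddCommGroup (Fr p M) := inferInstanceAs (AddCommGroup M)
instance (p : ℕ) (R : Type) [CommRing R] : CommRing (Fr p R) := inferInstanceAs (CommRing R)

/-- The identity map. -/
def mk (p : ℕ) {M : Type} (x : M) : Fr p M := x
/-- The identity map. -/
def out {p : ℕ} {M : Type} (x : Fr p M) : M := x

variable {p : ℕ} [hp : Fact p.Prime]

instance instModule (R M : Type) [CommRing R] [CharP R p] [AddCommGroup M] [Module R M] :
    Module R (Fr p M) :=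
  Module.compHom M (frobenius R p)

theorem smul_def {R M : Type} [CommRing R] [CharP R p] [AddCommGroup M] [Module R M] (r : R)
    (x : Fr p M) : r • x = mk p (r ^ p • out x) := rfl

/-- additive identity -/
def outEquiv (p : ℕ) (M : Type) [AddCommGroup M] : Fr p M ≃+ M := AddEquiv.refl M

/-- algebra structure -/
abbrev instAlg (R S : Type) [CommRing R] [CharP R p] [CommRing S] [Algebra R S] :
    Algebra R (Fr p S) :=
  Algebra.ofModule
    (fun r x y => smul_mul_assoc (r ^ p) (out x) (out y))
    (fun r x y => mul_smul_comm (r ^ p) (out x) (out y))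

instance (R S M : Type) [CommRing R] [CharP R p] [CommRing S] [CharP S p] [AddCommGroup M]
    [Algebra R S] [Module R M] [Module S M] [IsScalarTower R S M] :
    IsScalarTower R S (Fr p M) where
  smul_assoc r s x := by
    change ((r • s) ^ p) • out x = r ^ p • s ^ p • out x
    rw [smul_pow, smul_assoc]

/-- functoriality -/
def map (p : ℕ) [Fact p.Prime] {R M N : Type} [CommRing R] [CharP R p] [AddCommGroup M] [Module R M]
    [AddCommGroup N] [Module R N] (f : M →ₗ[R] N) : Fr p M →ₗ[R] Fr p N where
  toFun x := mk p (f (out x))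
  map_add' x y := f.map_add (out x) (out y)
  map_smul' r x := f.map_smul (r ^ p) (out x)

theorem map_surj {R M N : Type} [CommRing R] [CharP R p] [AddCommGroup M] [Module R M]
    [AddCommGroup N] [Module R N] (f : M →ₗ[R] N) (h : Function.Surjective f) :
    Function.Surjective (map p f) := h

theorem map_inj {R M N : Type} [CommRing R] [CharP R p] [AddCommGroup M] [Module R M]
    [AddCommGroup N] [Module R N] (f : M →ₗ[R] N) (h : Function.Injective f) :
    Function.Injective (map p f) := h

theorem map_exact {R M N K : Type} [CommRing R] [CharP R p] [AddCommGroup M] [Module R M]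
    [AddCommGroup N] [Module R N] [AddCommGroup K] [Module R K]
    (f : M →ₗ[R] N) (g : N →ₗ[R] K) (h : Function.Exact f g) :
    Function.Exact (map p f) (map p g) := h

/-- equivalences -/
noncomputable def mapEquiv (p : ℕ) [Fact p.Prime] {R M N : Type} [CommRing R] [CharP R p] [AddCommGroup M]
    [Module R M] [AddCommGroup N] [Module R N] (f : M ≃ₗ[R] N) : Fr p M ≃ₗ[R] Fr p N :=
  LinearEquiv.ofBijective (map p f.toLinearMap) f.bijective

theorem finite_of (A A' : Type) [CommRing A] [CharP A p] [CommRing A'] [CharP A' p]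
    (f : A →+* A') (hf : ∀ a' : A', ∃ (c : A') (a : A), a' = c ^ p * f a)
    [h : Module.Finite A (Fr p A)] : Module.Finite A' (Fr p A') := by
  obtain ⟨s, hs⟩ := h
  classical
  refine ⟨⟨s.image (fun x => mk p (f (out x))), ?_⟩⟩
  rw [eq_top_iff]
  rintro a' -
  obtain ⟨c, a, h⟩ := hf (out a')
  have key : ∀ x : Fr p A, mk p (f (out x)) ∈ Submodule.span A'
      ((s.image (fun x => mk p (f (out x))) : Finset (Fr p A')) : Set (Fr p A')) := by
    intro x
    have hx : x ∈ Submodule.span A (s : Set (Fr p A)) := by rw [hs]; trivial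
    induction hx using Submodule.span_induction with
    | mem x hx =>
      apply Submodule.subset_span
      simp only [Finset.coe_image]
      exact ⟨x, hx, rfl⟩
    | zero => 
      have : mk p (f (out (0 : Fr p A))) = 0 := f.map_zero
      rw [this]; exact Submodule.zero_mem _
    | add x y _ _ h1 h2 =>
      have : mk p (f (out (x + y))) = mk p (f (out x)) + mk p (f (out y)) := f.map_add _ _
      rw [this]; exact Submodule.add_mem _ h1 h2
    | smul r x _ h1 =>
      have : mk p (f (out (r • x))) = f r • mk p (f (out x)) := by
        change f (r ^ p * (out x)) = f r ^ p * f (out x)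
        simp
      rw [this]; exact Submodule.smul_mem _ _ h1
  have : a' = c • mk p (f (out (mk p a))) := h
  rw [this]
  exact Submodule.smul_mem _ _ (key _)

/-- the Frobenius rank -/
noncomputable def s (p : ℕ) [Fact p.Prime] (A : Type) [CommRing A] [CharP A p] : ℕ := Module.finrank A (Fr p A)

theorem s_eq_fraction (A K : Type) [CommRing A] [CharP A p] [CommRing K] [CharP K p]
    [Algebra A K] [IsFractionRing A K] : s p K = s p A := by
  let _ : Algebra A (Fr p A) := instAlg A A
  let _ : Algebra A (Fr p K) := instAlg A K
  let _ : Algebra (Fr p A) (Fr p K) := inferInstanceAs (Algebra A K)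
  have : IsFractionRing (Fr p A) (Fr p K) := inferInstanceAs (IsFractionRing A K)
  have : IsScalarTower A (Fr p A) (Fr p K) := ⟨fun a x y => by
    change (a ^ p • out x) • out y = a ^ p • (out x • out y)
    exact smul_assoc _ _ _⟩
  exact IsFractionRing.finrank_eq A K (Fr p A) (Fr p K)

theorem length_fr (A : Type) [CommRing A] [CharP A p] [IsLocalRing A]
    [CharP (IsLocalRing.ResidueField A) p]
    [Module.Finite (IsLocalRing.ResidueField A) (Fr p (IsLocalRing.ResidueField A))]
    (N : Type) [AddCommGroup N] [Module A N] (h : IsFiniteLength A N) :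
    Module.length A (Fr p N) = s p (IsLocalRing.ResidueField A) * Module.length A N := by
  induction h with
  | @of_subsingleton M _ _ hM =>
    have : Subsingleton (Fr p M) := hM
    simp
  | @of_simple_quotient M _ _ N hs h ih =>
    rw [Module.length_eq_add_of_exact N.subtype N.mkQ N.injective_subtype N.mkQ_surjective
      (LinearMap.exact_subtype_mkQ N),
      Module.length_eq_add_of_exact (map p N.subtype) (map p N.mkQ) (map_inj _ N.injective_subtype)
      (map_surj _ N.mkQ_surjective)
      (map_exact _ _ (LinearMap.exact_subtype_mkQ N)), ih, mul_add]
    congr 1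
    rw [Module.length_eq_one A (M ⧸ N)]
    obtain ⟨m, hm, ⟨e⟩⟩ := isSimpleModule_iff_quot_maximal.1 hs
    obtain rfl := IsLocalRing.eq_maximalIdeal hm
    rw [(mapEquiv p e).length_eq, mul_one]
    change Module.length A (Fr p (IsLocalRing.ResidueField A)) = _
    rw [Module.length_eq_of_surjective (R := IsLocalRing.ResidueField A) (S := A)
      IsLocalRing.residue_surjective, Module.length_eq_finrank, s]

end Fr

theorem exists_free_sub (A M : Type) [CommRing A] [IsDomain A] [AddCommGroup M] [Module A M]
    [Module.Finite A M] : ∃ f : (Fin (Module.finrank A M) → A) →ₗ[A] M, Function.Injective f ∧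
      Module.IsTorsion A (M ⧸ LinearMap.range f) := by
  obtain ⟨s, hs, hli⟩ := exists_set_linearIndependent_of_isDomain A M
  rw [← Module.finrank_eq_rank] at hs
  have hfin : Finite s := by
    rw [← Cardinal.lt_aleph0_iff_finite, hs]; exact Cardinal.natCast_lt_aleph0
  have hcard : Nat.card s = Module.finrank A M := by
    rw [Nat.card, hs, Cardinal.toNat_natCast]
  let e : Fin (Module.finrank A M) ≃ s := (Finite.equivFinOfCardEq hcard).symm
  have hli' : LinearIndependent A (fun i => ((e i : s) : M)) := hli.linearIndependent.comp e e.injective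
  have hr : LinearMap.range (Fintype.linearCombination A (fun i => ((e i : s) : M))) = Submodule.span A s := by
    rw [Fintype.range_linearCombination]
    congr 1
    ext x
    constructor
    · rintro ⟨i, rfl⟩; exact (e i).2
    · intro hx; exact ⟨e.symm ⟨x, hx⟩, by simp⟩
  refine ⟨Fintype.linearCombination A (fun i => ((e i : s) : M)), ?_, ?_⟩
  · exact hli'.fintypeLinearCombination_injective
  · rw [hr, ← Module.rank_eq_zero_iff_isTorsion]
    have h1 := rank_quotient_add_rank_of_isDomain (Submodule.span A s)
    have h2 : Module.rank A (Submodule.span A s) = Module.rank A M := by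
      have := rank_span_set hli
      rw [this, hs, Module.finrank_eq_rank]
    rw [h2] at h1
    have : Module.rank A M < Cardinal.aleph0 := Module.rank_lt_aleph0 A M
    nth_rewrite 2 [← zero_add (Module.rank A M)] at h1
    exact Cardinal.eq_of_add_eq_add_right h1 this

theorem torsion_killed (A M : Type) [CommRing A] [IsDomain A] [AddCommGroup M] [Module A M]
    [hM : Module.Finite A M] (h : Module.IsTorsion A M) : ∃ a : A, a ≠ 0 ∧ ∀ m : M, a • m = 0 := by
  obtain ⟨s, hs⟩ := hM
  choose c hc using fun m => @h m
  refine ⟨∏ m ∈ s, (c m : A), Finset.prod_ne_zero_iff.2 fun m _ => nonZeroDivisors.ne_zero (c m).2, ?_⟩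
  intro m
  have hm : m ∈ Submodule.span A (s : Set M) := by rw [hs]; trivial
  induction hm using Submodule.span_induction with
  | mem x hx =>
    obtain ⟨b, hb⟩ := Finset.dvd_prod_of_mem (fun m => (c m : A)) hx
    rw [hb, mul_comm, mul_smul]
    have := hc x
    rw [Submonoid.smul_def] at this
    rw [this, smul_zero]
  | zero => simp
  | add x y _ _ h1 h2 => rw [smul_add, h1, h2, add_zero]
  | smul r x _ h1 => rw [smul_comm, h1, smul_zero]

theorem torsion_finiteLength (A M : Type) [CommRing A] [IsDomain A] [IsNoetherianRing A]
    [Ring.KrullDimLE 1 A] [AddCommGroup M] [Module A M]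
    [hM : Module.Finite A M] (h : Module.IsTorsion A M) : IsFiniteLength A M := by
  obtain ⟨a, ha, hk⟩ := torsion_killed A M h
  obtain ⟨n, f, hf⟩ := Module.Finite.exists_fin' A M
  have h1 : IsFiniteLength A (A ⧸ Ideal.span {a}) :=
    isFiniteLength_quotient_span_singleton A (mem_nonZeroDivisors_of_ne_zero ha)
  have h2 : IsFiniteLength A (Fin n → A ⧸ Ideal.span {a}) := by
    rw [isFiniteLength_iff_isNoetherian_isArtinian] at h1 ⊢
    obtain ⟨_, _⟩ := h1
    exact ⟨inferInstance, inferInstance⟩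
  let g : (Fin n → A ⧸ Ideal.span {a}) →ₗ[A] M :=
    LinearMap.lsum A (fun _ => A ⧸ Ideal.span {a}) ℕ fun i =>
      Submodule.liftQ _ (f ∘ₗ LinearMap.single A (fun _ => A) i) (by
        change Ideal.span {a} ≤ _
        rw [Ideal.span_singleton_le_iff_mem, LinearMap.mem_ker]
        simp only [LinearMap.comp_apply]
        have : LinearMap.single A (fun _ : Fin n => A) i a = a • LinearMap.single A (fun _ => A) i 1 := by
          rw [← map_smul]; simp
        rw [this, map_smul, hk])
  have hg : Function.Surjective g := by
    intro m
    obtain ⟨v, rfl⟩ := hf m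
    refine ⟨fun i => Submodule.Quotient.mk (v i), ?_⟩
    simp only [g, LinearMap.lsum_apply, LinearMap.sum_apply, LinearMap.comp_apply, LinearMap.proj_apply,
      Submodule.liftQ_apply]
    rw [← map_sum]
    congr 1
    exact LinearMap.sum_single_apply _ v
  exact h2.of_surjective (f := g) hg

theorem length_quot_smul (A M : Type) [CommRing A] [IsDomain A] [IsNoetherianRing A]
    [Ring.KrullDimLE 1 A] [AddCommGroup M] [Module A M] [hM : Module.Finite A M] (x : A) (_hx : x ≠ 0)
    (hinj : ∀ m : M, x • m = 0 → m = 0) (Q : Type) [AddCommGroup Q] [Module A Q] (g : M →ₗ[A] Q)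
    (hg : Function.Surjective g) (hgk : ∀ m, g m = 0 ↔ ∃ m', m = x • m') :
    Module.length A Q = Module.finrank A M * Module.length A (A ⧸ Ideal.span {x}) := by
  obtain ⟨f, hf, ht⟩ := exists_free_sub A M
  have hfl := torsion_finiteLength A _ ht
  rw [← Module.length_ne_top_iff] at hfl
  set F := LinearMap.range f with hF
  let xF : Submodule A M := F.map (LinearMap.lsmul A M x)
  have hxF : ∀ m, m ∈ xF ↔ ∃ v, m = x • f v := by
    intro m
    simp only [xF, Submodule.mem_map, hF, LinearMap.mem_range]
    constructor
    · rintro ⟨_, ⟨v, rfl⟩, rfl⟩; exact ⟨v, rfl⟩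
    · rintro ⟨v, rfl⟩; exact ⟨_, ⟨v, rfl⟩, rfl⟩
  -- first sequence
  let a1 : (M ⧸ F) →ₗ[A] (M ⧸ xF) := Submodule.mapQ F xF (LinearMap.lsmul A M x) (Submodule.le_comap_map _ _)
  let b1 : (M ⧸ xF) →ₗ[A] Q := Submodule.liftQ xF g (by
    intro m hm
    obtain ⟨v, rfl⟩ := (hxF m).1 hm
    exact (hgk _).2 ⟨_, rfl⟩)
  have e1 := Module.length_eq_add_of_exact a1 b1 (by
      rw [injective_iff_map_eq_zero]
      intro m
      obtain ⟨m, rfl⟩ := Submodule.Quotient.mk_surjective _ m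
      intro h
      simp only [a1, Submodule.mapQ_apply, LinearMap.lsmul_apply, Submodule.Quotient.mk_eq_zero] at h ⊢
      obtain ⟨v, hv⟩ := (hxF _).1 h
      have := hinj (m - f v) (by rw [smul_sub, hv, sub_self])
      rw [sub_eq_zero] at this
      exact ⟨v, this.symm⟩)
    (by
      intro q
      obtain ⟨m, rfl⟩ := hg q
      exact ⟨Submodule.Quotient.mk m, by simp [b1]⟩)
    (by
      intro m
      obtain ⟨m, rfl⟩ := Submodule.Quotient.mk_surjective _ m
      simp only [b1, Submodule.liftQ_apply, hgk]
      constructor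
      · rintro ⟨m', rfl⟩
        exact ⟨Submodule.Quotient.mk m', by simp [a1]⟩
      · rintro ⟨m', h⟩
        obtain ⟨m', rfl⟩ := Submodule.Quotient.mk_surjective _ m'
        simp only [a1, Submodule.mapQ_apply, LinearMap.lsmul_apply] at h
        rw [Submodule.Quotient.eq] at h
        obtain ⟨v, hv⟩ := (hxF _).1 h
        exact ⟨m' - f v, by rw [smul_sub, ← hv]; abel⟩)
  -- second sequence
  let I : Ideal A := Ideal.span {x}
  let G : (Fin (Module.finrank A M) → A) →ₗ[A] (Fin (Module.finrank A M) → A ⧸ I) :=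
    LinearMap.pi fun i => (Submodule.mkQ I) ∘ₗ LinearMap.proj i
  have hG : Function.Surjective G := by
    intro w
    choose v hv using fun i => Submodule.Quotient.mk_surjective I (w i)
    exact ⟨v, funext hv⟩
  have hGk : ∀ v, G v = 0 ↔ ∃ w, v = x • w := by
    intro v
    constructor
    · intro h
      have : ∀ i, ∃ c, v i = x * c := by
        intro i
        have := congrFun h i
        simp only [G, LinearMap.pi_apply, LinearMap.comp_apply, LinearMap.proj_apply,
          Submodule.mkQ_apply, Pi.zero_apply, Submodule.Quotient.mk_eq_zero] at this
        exact Ideal.mem_span_singleton.1 this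
      choose w hw using this
      exact ⟨w, funext hw⟩
    · rintro ⟨w, rfl⟩
      funext i
      simp only [G, LinearMap.pi_apply, LinearMap.comp_apply, LinearMap.proj_apply,
          Submodule.mkQ_apply, Pi.zero_apply, Submodule.Quotient.mk_eq_zero]
      exact Ideal.mem_span_singleton.2 ⟨w i, rfl⟩
  let eG := G.quotKerEquivOfSurjective hG
  let a2' : ((Fin (Module.finrank A M) → A) ⧸ LinearMap.ker G) →ₗ[A] M ⧸ xF :=
    Submodule.mapQ _ _ f (by
      intro v hv
      obtain ⟨w, rfl⟩ := (hGk v).1 hv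
      exact (hxF _).2 ⟨w, by simp⟩)
  let b2 : (M ⧸ xF) →ₗ[A] M ⧸ F := Submodule.mapQ xF F LinearMap.id (by
    intro m hm
    obtain ⟨v, rfl⟩ := (hxF m).1 hm
    exact F.smul_mem _ ⟨v, rfl⟩)
  have e2 := Module.length_eq_add_of_exact a2' b2 (by
      rw [injective_iff_map_eq_zero]
      intro m
      obtain ⟨m, rfl⟩ := Submodule.Quotient.mk_surjective _ m
      intro h
      simp only [a2', Submodule.mapQ_apply, Submodule.Quotient.mk_eq_zero] at h ⊢
      obtain ⟨v, hv⟩ := (hxF _).1 h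
      rw [← map_smul] at hv
      exact (hGk _).2 ⟨v, hf hv⟩)
    (by
      intro q
      obtain ⟨m, rfl⟩ := Submodule.Quotient.mk_surjective _ q
      exact ⟨Submodule.Quotient.mk m, by simp [b2]⟩)
    (by
      intro m
      obtain ⟨m, rfl⟩ := Submodule.Quotient.mk_surjective _ m
      simp only [b2, Submodule.mapQ_apply, LinearMap.id_apply, Submodule.Quotient.mk_eq_zero]
      constructor
      · rintro ⟨v, rfl⟩
        exact ⟨Submodule.Quotient.mk v, by simp [a2']⟩
      · rintro ⟨m', h⟩
        obtain ⟨m', rfl⟩ := Submodule.Quotient.mk_surjective _ m'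
        simp only [a2', Submodule.mapQ_apply] at h
        rw [Submodule.Quotient.eq] at h
        obtain ⟨v, hv⟩ := (hxF _).1 h
        refine ⟨m' - x • v, ?_⟩
        rw [map_sub, map_smul, ← hv]; abel)
  rw [e2, eG.length_eq, Module.length_pi, add_comm] at e1
  have := ENat.add_right_injective_of_ne_top hfl e1
  rw [← this]
  simp [I]

namespace Fr

theorem one_dim (p : ℕ) [hp : Fact p.Prime] (A : Type) [CommRing A] [IsDomain A] [IsNoetherianRing A]
    [IsLocalRing A] [CharP A p] [Ring.KrullDimLE 1 A] (x : A) (hx0 : x ≠ 0)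
    (hxm : x ∈ IsLocalRing.maximalIdeal A)
    [CharP (IsLocalRing.ResidueField A) p] [Module.Finite A (Fr p A)] :
    s p A = p * s p (IsLocalRing.ResidueField A) := by
  have hfin : Module.Finite (IsLocalRing.ResidueField A) (Fr p (IsLocalRing.ResidueField A)) :=
    finite_of A _ (IsLocalRing.residue A) fun a' => by
      obtain ⟨a, rfl⟩ := IsLocalRing.residue_surjective a'
      exact ⟨1, a, by simp⟩
  have hxn := mem_nonZeroDivisors_of_ne_zero hx0
  have h1 := length_quot_smul A (Fr p A) x hx0 (by
    intro m hm
    have : x ^ p * out m = 0 := hm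
    exact (mul_eq_zero.1 this).resolve_left (pow_ne_zero _ hx0))
    (Fr p (A ⧸ Ideal.span {x ^ p})) (map p (Submodule.mkQ (Ideal.span {x ^ p})))
    (map_surj _ (Submodule.mkQ_surjective _)) (by
      intro m
      have : map p (Submodule.mkQ (Ideal.span {x ^ p})) m = 0 ↔ out m ∈ Ideal.span {x ^ p} :=
        Submodule.Quotient.mk_eq_zero _
      rw [this, Ideal.mem_span_singleton]
      rfl)
  rw [length_fr A _ (isFiniteLength_quotient_span_singleton A (pow_mem hxn p))] at h1
  have h2 := Ring.ord_pow hxn p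
  rw [Ring.ord, Ring.ord] at h2
  rw [h2] at h1
  have h3 := Module.length_ne_top_iff.2 (isFiniteLength_quotient_span_singleton A hxn)
  have h4 : Module.length A (A ⧸ Ideal.span {x}) ≠ 0 := by
    rw [Ne, Module.length_eq_zero_iff, Submodule.Quotient.subsingleton_iff]
    intro h
    rw [IsLocalRing.mem_maximalIdeal, mem_nonunits_iff] at hxm
    exact hxm (Ideal.span_singleton_eq_top.1 h)
  obtain ⟨n, hn⟩ := ENat.ne_top_iff_exists.1 h3
  rw [← hn] at h1 h4
  rw [nsmul_eq_mul] at h1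
  have h5 : s p (IsLocalRing.ResidueField A) * (p * n) = s p A * n := by
    exact_mod_cast h1
  have h6 : 0 < n := Nat.pos_of_ne_zero (by exact_mod_cast h4)
  apply Nat.eq_of_mul_eq_mul_right h6
  rw [← h5]; ring

end Fr

theorem dim_quot_eq_coheight {R : Type} [CommRing R] (P : PrimeSpectrum R) :
    ringKrullDim (R ⧸ P.asIdeal) = Order.coheight P := by
  rw [ringKrullDim_quotient, Order.coheight_eq_krullDim_Ici]
  rfl

theorem charP_of_hom {R S : Type} [CommRing R] [CommRing S] [Nontrivial S] (p : ℕ) [hp : Fact p.Prime]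
    [CharP R p] (f : R →+* S) : CharP S p := by
  rw [CharP.charP_iff_prime_eq_zero hp.out]
  rw [← map_natCast f, CharP.cast_eq_zero, map_zero]

namespace Fr

theorem kunz (p : ℕ) [hp : Fact p.Prime] (n : ℕ) : ∀ (A : Type) [CommRing A] [IsDomain A]
    [IsNoetherianRing A] [IsLocalRing A] [CharP A p] [Module.Finite A (Fr p A)]
    (_ : ∀ a : A, ∃ b : A, a - b ^ p ∈ IsLocalRing.maximalIdeal A)
    (_ : ringKrullDim A = n), s p A = p ^ n := by
  induction n with
  | zero =>
    intro A _ _ _ _ _ _ hperf hdim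
    have hF : IsField A := by
      have : Ring.KrullDimLE 0 A := by
        rw [Ring.krullDimLE_iff, hdim]
      exact Ring.KrullDimLE.isField_of_isDomain
    rw [IsLocalRing.isField_iff_maximalIdeal_eq] at hF
    rw [pow_zero, s]
    have hb : Function.Bijective (LinearMap.toSpanSingleton A (Fr p A) (mk p (1 : A))) := by
      constructor
      · rw [injective_iff_map_eq_zero]
        intro b h
        have : b ^ p * 1 = 0 := h
        rw [mul_one] at this
        exact pow_eq_zero_iff hp.out.ne_zero |>.1 this
      · intro w
        obtain ⟨b, hb⟩ := hperf (out w)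
        rw [hF, Ideal.mem_bot, sub_eq_zero] at hb
        refine ⟨b, ?_⟩
        change b ^ p * 1 = out w
        rw [hb, mul_one]
    rw [← (LinearEquiv.ofBijective _ hb).finrank_eq, Module.finrank_self]
  | succ n ih =>
    intro A _ _ _ _ _ _ hperf hdim
    have h0 : Order.coheight (⊥ : PrimeSpectrum A) = n + 1 := by
      have := Order.coheight_bot_eq_krullDim (α := PrimeSpectrum A)
      rw [show Order.krullDim (PrimeSpectrum A) = _ from hdim] at this
      exact_mod_cast this
    obtain ⟨-, ⟨Q, hQ, hQn⟩, hle⟩ := Order.coheight_eq_coe_add_one_iff.1 h0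
    have hQ1 : Q.asIdeal.height ≤ 1 := by
      rw [show (1 : ℕ∞) = ((1 : ℕ) : ℕ∞) from rfl, Ideal.height_le_iff]
      intro q hq hqQ
      by_cases hqb : q = ⊥
      · rw [hqb, Ideal.height_bot]; simp
      exfalso
      have hq1 : (⊥ : PrimeSpectrum A) < ⟨q, hq⟩ :=
        lt_of_le_of_ne bot_le fun h => hqb (congrArg PrimeSpectrum.asIdeal h).symm
      have hq2 : (⟨q, hq⟩ : PrimeSpectrum A) < Q := hqQ
      have h3 := Order.coheight_add_one_le hq2
      rw [hQn] at h3
      have h4 := h3.trans (hle _ hq1)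
      have h5 : n + 1 ≤ n := by exact_mod_cast h4
      omega
    have hQ0 : Q.asIdeal ≠ ⊥ := by
      intro h
      exact hQ.ne' (PrimeSpectrum.ext h)
    obtain ⟨x, hxQ, hx0⟩ := Submodule.exists_mem_ne_zero_of_ne_bot hQ0
    let L := Localization.AtPrime Q.asIdeal
    have : IsDomain L := IsLocalization.isDomain_localization (Ideal.primeCompl_le_nonZeroDivisors _)
    have : IsNoetherianRing L := IsLocalization.isNoetherianRing Q.asIdeal.primeCompl L inferInstance
    have : CharP L p := charP_of_hom p (algebraMap A L)
    have : CharP (IsLocalRing.ResidueField L) p := charP_of_hom p (algebraMap L _)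
    have : CharP (A ⧸ Q.asIdeal) p := charP_of_hom p (algebraMap A _)
    have : Ring.KrullDimLE 1 L := by
      rw [Ring.krullDimLE_iff, IsLocalization.AtPrime.ringKrullDim_eq_height Q.asIdeal L]
      exact_mod_cast hQ1
    have : Module.Finite L (Fr p L) := finite_of A L (algebraMap A L) (by
      intro a'
      obtain ⟨a, t, rfl⟩ := IsLocalization.exists_mk'_eq Q.asIdeal.primeCompl a'
      refine ⟨IsLocalization.mk' L 1 t, a * t ^ (p - 1), ?_⟩
      rw [IsLocalization.mk'_eq_iff_eq_mul, map_mul, map_pow]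
      have h1 : IsLocalization.mk' L 1 t * algebraMap A L t = 1 := by
        rw [IsLocalization.mk'_spec, map_one]
      obtain ⟨q, hq⟩ := Nat.exists_eq_succ_of_ne_zero hp.out.ne_zero
      rw [hq, Nat.succ_sub_one]
      calc _ = algebraMap A L a * (IsLocalization.mk' L 1 t * algebraMap A L t) ^ (q + 1) := by
            rw [h1, one_pow, mul_one]
        _ = _ := by rw [Nat.succ_eq_add_one]; ring)
    have e1 := one_dim p L (algebraMap A L x) (by
        intro h
        exact hx0 ((IsLocalization.injective L (Ideal.primeCompl_le_nonZeroDivisors Q.asIdeal)) (by rw [h, map_zero])))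
      ((IsLocalization.AtPrime.to_map_mem_maximal_iff L Q.asIdeal x).2 hxQ)
    have : CharP (FractionRing A) p := charP_of_hom p (algebraMap A _)
    let _ : Algebra L (FractionRing A) := IsLocalization.localizationAlgebraOfSubmonoidLe L (FractionRing A)
       Q.asIdeal.primeCompl (nonZeroDivisors A) (Ideal.primeCompl_le_nonZeroDivisors Q.asIdeal)
    have : IsScalarTower A L (FractionRing A) := IsLocalization.localization_isScalarTower_of_submonoid_le _ _ _ _ _
    have : IsFractionRing L (FractionRing A) :=
      IsFractionRing.isFractionRing_of_isDomain_of_isLocalization Q.asIdeal.primeCompl L (FractionRing A)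
    have e2 : s p A = s p L := by
      rw [← s_eq_fraction A (FractionRing A), ← s_eq_fraction L (FractionRing A)]
    have e3 : s p (IsLocalRing.ResidueField L) = s p (A ⧸ Q.asIdeal) :=
      have : CharP Q.asIdeal.ResidueField p := ‹CharP (IsLocalRing.ResidueField L) p›
      s_eq_fraction (A ⧸ Q.asIdeal) Q.asIdeal.ResidueField
    have : IsLocalRing (A ⧸ Q.asIdeal) := .of_surjective' (Ideal.Quotient.mk _) Ideal.Quotient.mk_surjective
    have : Module.Finite (A ⧸ Q.asIdeal) (Fr p (A ⧸ Q.asIdeal)) := finite_of A _ (Ideal.Quotient.mk _) fun a' => by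
      obtain ⟨a, rfl⟩ := Ideal.Quotient.mk_surjective a'
      exact ⟨1, a, by simp⟩
    have e4 := ih (A ⧸ Q.asIdeal) (by
      intro a'
      obtain ⟨a, rfl⟩ := Ideal.Quotient.mk_surjective a'
      obtain ⟨b, hb⟩ := hperf a
      refine ⟨Ideal.Quotient.mk _ b, ?_⟩
      rw [← map_pow, ← map_sub]
      rw [IsLocalRing.mem_maximalIdeal, mem_nonunits_iff] at hb ⊢
      have : IsLocalHom (Ideal.Quotient.mk Q.asIdeal) :=
        .of_surjective _ Ideal.Quotient.mk_surjective
      exact fun h => hb (isUnit_of_map_unit (Ideal.Quotient.mk Q.asIdeal) _ h))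
      (by rw [dim_quot_eq_coheight, hQn]; rfl)
    rw [e2, e1, e3, e4, pow_succ, mul_comm]

end Fr

namespace Fr

theorem cls_exact {B : Type} [CommRing B] {M' M M'' : Type} [AddCommGroup M'] [Module B M']
    [Module.Finite B M'] [AddCommGroup M] [Module B M] [Module.Finite B M] [AddCommGroup M'']
    [Module B M''] [Module.Finite B M''] (f : M' →ₗ[B] M) (g : M →ₗ[B] M'')
    (hf : Function.Injective f) (hg : Function.Surjective g) (h : Function.Exact f g) :
    G0.cls (FGMod.mk (B := B) M) = G0.cls (FGMod.mk (B := B) M') + G0.cls (FGMod.mk (B := B) M'') := by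
  have : (QuotientAddGroup.mk (FreeAbelianGroup.of (FGMod.mk (B := B) M)
      - FreeAbelianGroup.of (FGMod.mk (B := B) M') - FreeAbelianGroup.of (FGMod.mk (B := B) M'')) :
      FreeAbelianGroup (FGMod B) ⧸ G0Relations B) = 0 := by
    rw [QuotientAddGroup.eq_zero_iff]
    exact AddSubgroup.subset_closure ⟨FGMod.mk M', FGMod.mk M, FGMod.mk M'', f, g, hf, hg,
      (LinearMap.exact_iff.1 h).symm, rfl⟩
  have h2 : G0.cls (FGMod.mk (B := B) M) - G0.cls (FGMod.mk (B := B) M')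
    - G0.cls (FGMod.mk (B := B) M'') = 0 := by
    rw [QuotientAddGroup.mk_sub, QuotientAddGroup.mk_sub] at this
    exact this
  rw [sub_sub, sub_eq_zero] at h2
  exact h2

theorem cls_zero {B : Type} [CommRing B] (M : Type) [AddCommGroup M] [Module B M]
    [Module.Finite B M] [Subsingleton M] : G0.cls (FGMod.mk (B := B) M) = 0 := by
  have := cls_exact (B := B) (0 : M →ₗ[B] M) (0 : M →ₗ[B] M) (fun _ _ _ => Subsingleton.elim _ _)
    (fun x => ⟨x, Subsingleton.elim _ _⟩)
    (fun x => ⟨fun _ => ⟨x, Subsingleton.elim _ _⟩, fun _ => Subsingleton.elim _ _⟩)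
  exact left_eq_add.1 this

theorem cls_equiv {B : Type} [CommRing B] {M N : Type} [AddCommGroup M] [Module B M]
    [Module.Finite B M] [AddCommGroup N] [Module B N] [Module.Finite B N] (e : M ≃ₗ[B] N) :
    G0.cls (FGMod.mk (B := B) M) = G0.cls (FGMod.mk (B := B) N) := by
  have := cls_exact (B := B) (0 : PUnit →ₗ[B] M) e.toLinearMap (fun _ _ _ => Subsingleton.elim _ _)
    e.surjective (by
      intro x
      simp [eq_comm (a := (0 : M))])
  rw [this, cls_zero PUnit, zero_add]

theorem cls_pi {B : Type} [CommRing B] (M : Type) [AddCommGroup M] [Module B M]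
    [Module.Finite B M] (n : ℕ) :
    G0.cls (FGMod.mk (B := B) (Fin n → M)) = n • G0.cls (FGMod.mk (B := B) M) := by
  induction n with
  | zero => rw [cls_zero, zero_smul]
  | succ n ih =>
    rw [cls_exact (LinearMap.single B (fun _ : Fin (n + 1) => M) 0)
      (LinearMap.funLeft B M (Fin.succ : Fin n → Fin (n + 1)))
      (Pi.single_injective (M := fun _ : Fin (n + 1) => M) 0) (LinearMap.funLeft_surjective_of_injective _ _ _ (Fin.succ_injective n)) ?_,
      ih, succ_nsmul, add_comm]
    intro v
    constructor
    · intro h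
      refine ⟨v 0, ?_⟩
      funext i
      refine Fin.cases ?_ (fun i => ?_) i
      · simp
      · have := congrFun h i
        simp only [LinearMap.funLeft_apply] at this
        simp [this]
    · rintro ⟨m, rfl⟩
      funext i
      simp [LinearMap.funLeft_apply]

theorem linalg {V : Type*} [AddCommGroup V] [Module ℚ V] (t : Module.End ℚ V) (p : ℕ) (hp : 1 < p)
    (W : ℕ → Submodule ℚ V) (h0 : W 0 = ⊥)
    (hW : ∀ i, ∀ v ∈ W (i + 1), t v - (p : ℚ) ^ i • v ∈ W i) (i : ℕ) :
    W i ≤ ⨆ j : Fin i, Module.End.eigenspace t ((p : ℚ) ^ (j : ℕ)) := by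
  induction i with
  | zero => rw [h0]; exact bot_le
  | succ i ih =>
    intro v hv
    have h1 := ih (hW i v hv)
    have key : ∀ u ∈ ⨆ j : Fin i, Module.End.eigenspace t ((p : ℚ) ^ (j : ℕ)),
        ∃ w ∈ ⨆ j : Fin i, Module.End.eigenspace t ((p : ℚ) ^ (j : ℕ)), t w - (p : ℚ) ^ i • w = u := by
      intro u hu
      induction hu using Submodule.iSup_induction' with
      | mem j x hx =>
        have hne : (p : ℚ) ^ (j : ℕ) - (p : ℚ) ^ i ≠ 0 := by
          rw [sub_ne_zero]
          have : p ^ (j : ℕ) ≠ p ^ i := fun h => j.2.ne (Nat.pow_right_injective hp h)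
          exact_mod_cast this
        refine ⟨((p : ℚ) ^ (j : ℕ) - (p : ℚ) ^ i)⁻¹ • x,
          Submodule.smul_mem _ _ (Submodule.mem_iSup_of_mem j hx), ?_⟩
        rw [map_smul, Module.End.mem_eigenspace_iff.1 hx, smul_comm ((p : ℚ) ^ i), ← smul_sub, ← sub_smul,
          smul_smul, inv_mul_cancel₀ hne, one_smul]
      | zero => exact ⟨0, Submodule.zero_mem _, by simp⟩
      | add x y _ _ hx hy =>
        obtain ⟨a, ha, rfl⟩ := hx
        obtain ⟨b, hb, rfl⟩ := hy
        exact ⟨a + b, Submodule.add_mem _ ha hb, by rw [map_add, smul_add]; abel⟩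
    obtain ⟨w, hw, hwv⟩ := key _ h1
    have hle : (⨆ j : Fin i, Module.End.eigenspace t ((p : ℚ) ^ (j : ℕ))) ≤
        ⨆ j : Fin (i + 1), Module.End.eigenspace t ((p : ℚ) ^ (j : ℕ)) :=
      iSup_le fun j => le_iSup (fun j : Fin (i + 1) => Module.End.eigenspace t ((p : ℚ) ^ (j : ℕ))) j.castSucc
    have h2 : v - w ∈ Module.End.eigenspace t ((p : ℚ) ^ ((Fin.last i : Fin (i + 1)) : ℕ)) := by
      rw [Module.End.mem_eigenspace_iff, Fin.val_last, map_sub, smul_sub]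
      rw [sub_eq_sub_iff_add_eq_add] at hwv
      rw [sub_eq_sub_iff_add_eq_add, add_comm _ (t w), hwv, add_comm]
    have h3 := Submodule.mem_iSup_of_mem (p := fun j : Fin (i + 1) =>
      Module.End.eigenspace t ((p : ℚ) ^ (j : ℕ))) (Fin.last i) h2
    have := Submodule.add_mem _ h3 (hle hw)
    rwa [sub_add_cancel] at this

/-- rational class -/
noncomputable def q {B : Type} [CommRing B] (x : G0 B) : TensorProduct ℤ ℚ (G0 B) := TensorProduct.tmul ℤ 1 x

/-- dimension filtration -/
noncomputable def W (B : Type) [CommRing B] (i : ℕ) : Submodule ℚ (TensorProduct ℤ ℚ (G0 B)) :=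
  Submodule.span ℚ {v | ∃ P : PrimeSpectrum B, Order.coheight P < i ∧
    v = q (G0.cls (FGMod.mk (B := B) (B ⧸ P.asIdeal)))}

theorem W_mono (B : Type) [CommRing B] {i j : ℕ} (h : i ≤ j) : W B i ≤ W B j := by
  apply Submodule.span_mono
  rintro v ⟨P, hP, rfl⟩
  exact ⟨P, hP.trans_le (by exact_mod_cast h), rfl⟩

theorem q_add {B : Type} [CommRing B] (x y : G0 B) : q (x + y) = q x + q y := TensorProduct.tmul_add _ _ _

theorem q_neg {B : Type} [CommRing B] (x : G0 B) : q (-x) = - q x := TensorProduct.tmul_neg _ _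

theorem q_neg_mem {B : Type} [CommRing B] {i : ℕ} {x : G0 B} (h : q x ∈ W B i) : q (-x) ∈ W B i := by
  rw [q_neg]
  exact Submodule.neg_mem _ h

theorem q_add_mem {B : Type} [CommRing B] {i : ℕ} {x y : G0 B} (h : q x ∈ W B i) (h' : q y ∈ W B i) :
    q (x + y) ∈ W B i := by
  rw [q_add]
  exact Submodule.add_mem _ h h'

theorem mem_W {B : Type} [CommRing B] [IsNoetherianRing B] (i : ℕ) (M : Type) [AddCommGroup M]
    [Module B M] [hM : Module.Finite B M] (h : ∀ P ∈ Module.support B M, Order.coheight P < i) :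
    q (G0.cls (FGMod.mk (B := B) M)) ∈ W B i := by
  induction hM using IsNoetherianRing.induction_on_isQuotientEquivQuotientPrime B with
  | subsingleton N => rw [cls_zero, q, TensorProduct.tmul_zero]; exact Submodule.zero_mem _
  | quotient N P e =>
    rw [cls_equiv e]
    refine Submodule.subset_span ⟨P, h P ?_, rfl⟩
    rw [e.support_eq, Module.mem_support_iff_of_finite, Ideal.annihilator_quotient]
  | exact N₁ N₂ N₃ f g hf hg hfg h₁ h₃ =>
    rw [cls_exact f g hf hg hfg, q_add]
    exact Submodule.add_mem _ (h₁ fun P hP => h P (Module.support_subset_of_injective f hf hP))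
      (h₃ fun P hP => h P (Module.support_subset_of_surjective g hg hP))

theorem finite_quot (B A M : Type) [CommRing B] [CommRing A] [Algebra B A] [AddCommGroup M]
    [Module B M] [Module A M] [IsScalarTower B A M] [Module.Finite B M] (N : Submodule A M) :
    Module.Finite B (M ⧸ N) := by
  let g : M →ₗ[B] M ⧸ N := N.mkQ.restrictScalars B
  exact Module.Finite.of_surjective g (Submodule.mkQ_surjective N)

theorem gen_step_aux {B : Type} [CommRing B] [IsNoetherianRing B] (P : PrimeSpectrum B) (c r : ℕ)
    (A : Type) [CommRing A] [IsDomain A] [IsNoetherianRing A] [Algebra B A] [Module.Finite B A]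
    (hA : Function.Surjective (algebraMap B A)) (hAP : ∀ x, algebraMap B A x = 0 ↔ x ∈ P.asIdeal)
    (hc : Order.coheight P = c) (M : Type) [AddCommGroup M] [Module B M] [Module A M]
    [IsScalarTower B A M] [Module.Finite B M] [Module.Finite A M]
    (f : (Fin r → A) →ₗ[A] M) (hf : Function.Injective f)
    (a : A) (ha : a ≠ 0) (hk : ∀ m : M ⧸ LinearMap.range f, a • m = 0) :
    q (G0.cls (FGMod.mk (B := B) M)) -
      (r : ℚ) • q (G0.cls (FGMod.mk (B := B) A)) ∈ W B c := by
  have hfin : Module.Finite B (M ⧸ LinearMap.range f) :=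
    finite_quot B A M _
  let f' : (Fin r → A) →ₗ[B] M := f.restrictScalars B
  let g' : M →ₗ[B] M ⧸ LinearMap.range f := (LinearMap.range f).mkQ.restrictScalars B
  have h1 : G0.cls (FGMod.mk (B := B) M) = G0.cls (FGMod.mk (B := B) (Fin r → A)) +
      G0.cls (FGMod.mk (B := B) (M ⧸ LinearMap.range f)) :=
    cls_exact f' g' hf (Submodule.mkQ_surjective (LinearMap.range f)) (LinearMap.exact_map_mkQ_range f)
  have h1' : G0.cls (FGMod.mk (B := B) M) = r • G0.cls (FGMod.mk (B := B) A) +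
      G0.cls (FGMod.mk (B := B) (M ⧸ LinearMap.range f)) := h1.trans (congrArg (· + _) (cls_pi A r))
  rw [h1', q_add]
  have h2 : q (r • G0.cls (FGMod.mk (B := B) A)) =
      (r : ℚ) • q (G0.cls (FGMod.mk (B := B) A)) := by
    rw [q, TensorProduct.tmul_smul, Nat.cast_smul_eq_nsmul]; rfl
  rw [h2, add_sub_cancel_left]
  apply mem_W
  intro Q hQ
  have hann := Module.annihilator_le_of_mem_support hQ
  obtain ⟨b, rfl⟩ := hA a
  have hbQ : b ∈ Q.asIdeal := hann (by
    rw [Module.mem_annihilator]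
    intro m
    rw [← hk m, algebraMap_smul])
  have hbP : b ∉ P.asIdeal := fun h => ha ((hAP b).2 h)
  have hPQ : P.asIdeal ≤ Q.asIdeal := fun x hx => hann (by
    rw [Module.mem_annihilator]
    intro m
    rw [← algebraMap_smul A x m, (hAP x).2 hx, zero_smul])
  have hlt : P < Q := lt_of_le_of_ne hPQ (by rintro rfl; exact hbP hbQ)
  have h3 := Order.coheight_add_one_le hlt
  rw [hc] at h3
  exact (ENat.add_one_le_iff (ne_top_of_le_ne_top (ENat.coe_ne_top c) (le_self_add.trans h3))).1 h3

theorem gen_step {B : Type} [CommRing B] [IsNoetherianRing B] (P : PrimeSpectrum B) (c r : ℕ)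
    (A : Type) [CommRing A] [IsDomain A] [IsNoetherianRing A] [Algebra B A] [Module.Finite B A]
    (hA : Function.Surjective (algebraMap B A)) (hAP : ∀ x, algebraMap B A x = 0 ↔ x ∈ P.asIdeal)
    (hc : Order.coheight P = c) (M : Type) [AddCommGroup M] [Module B M] [Module A M]
    [IsScalarTower B A M] [Module.Finite B M] [Module.Finite A M]
    (hs : Module.finrank A M = r) :
    q (G0.cls (FGMod.mk (B := B) M)) -
      (r : ℚ) • q (G0.cls (FGMod.mk (B := B) A)) ∈ W B c := by
  have hex := exists_free_sub A M
  rw [hs] at hex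
  obtain ⟨f, hf, ht⟩ := hex
  obtain ⟨a, ha, hk⟩ := torsion_killed _ _ ht
  exact gen_step_aux P c r A hA hAP hc M f hf a ha hk

theorem main_step {B : Type} [CommRing B] [IsNoetherianRing B] [IsLocalRing B]
    (p : ℕ) [hp : Fact p.Prime] [CharP B p]
    (hperf : ∀ a : B, ∃ b : B, a - b ^ p ∈ IsLocalRing.maximalIdeal B)
    [Module.Finite B (Fr p B)] (P : PrimeSpectrum B) (c : ℕ) (hc : Order.coheight P = c)
    [Module.Finite B (Fr p (B ⧸ P.asIdeal))] :
    q (G0.cls (FGMod.mk (B := B) (Fr p (B ⧸ P.asIdeal)))) -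
      (p : ℚ) ^ c • q (G0.cls (FGMod.mk (B := B) (B ⧸ P.asIdeal))) ∈ W B c := by
  have : CharP (B ⧸ P.asIdeal) p := charP_of_hom p (algebraMap B _)
  have : IsLocalRing (B ⧸ P.asIdeal) := .of_surjective' (Ideal.Quotient.mk _) Ideal.Quotient.mk_surjective
  have : Module.Finite (B ⧸ P.asIdeal) (Fr p (B ⧸ P.asIdeal)) := finite_of B _ (Ideal.Quotient.mk _) fun a' => by
      obtain ⟨a, rfl⟩ := Ideal.Quotient.mk_surjective a'
      exact ⟨1, a, by simp⟩
  have hs := kunz p c (B ⧸ P.asIdeal) (by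
      intro a'
      obtain ⟨a, rfl⟩ := Ideal.Quotient.mk_surjective a'
      obtain ⟨b, hb⟩ := hperf a
      refine ⟨Ideal.Quotient.mk _ b, ?_⟩
      rw [← map_pow, ← map_sub]
      rw [IsLocalRing.mem_maximalIdeal, mem_nonunits_iff] at hb ⊢
      have : IsLocalHom (Ideal.Quotient.mk P.asIdeal) :=
        .of_surjective _ Ideal.Quotient.mk_surjective
      exact fun h => hb (isUnit_of_map_unit (Ideal.Quotient.mk P.asIdeal) _ h))
      (by rw [dim_quot_eq_coheight, hc]; rfl)
  change Module.finrank _ _ = _ at hs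
  have h := gen_step P c (p ^ c) (B ⧸ P.asIdeal) Ideal.Quotient.mk_surjective
    (fun _ => Ideal.Quotient.eq_zero_iff_mem) hc (Fr p (B ⧸ P.asIdeal)) hs
  rw [Nat.cast_pow] at h
  exact h

theorem W_top {B : Type} [CommRing B] [IsNoetherianRing B] (d : ℕ) (hd : ringKrullDim B = d) :
    W B (d + 1) = ⊤ := by
  rw [eq_top_iff]
  have key : ∀ x : G0 B, q x ∈ W B (d + 1) := by
    intro x
    obtain ⟨y, rfl⟩ := QuotientAddGroup.mk_surjective x
    induction y using FreeAbelianGroup.induction_on with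
    | zero => 
      have : q (0 : G0 B) = 0 := by rw [q, TensorProduct.tmul_zero]
      change q (0 : G0 B) ∈ _
      rw [this]
      exact Submodule.zero_mem _
    | of M =>
      refine mem_W (d + 1) M.carrier fun P _ => ?_
      have := Order.coheight_le_krullDim P
      rw [show Order.krullDim (PrimeSpectrum B) = _ from hd] at this
      have h2 : Order.coheight P ≤ d := by exact_mod_cast this
      exact h2.trans_lt (by exact_mod_cast Nat.lt_succ_self d)
    | neg M h =>
      exact q_neg_mem h
    | add x y hx hy =>
      exact q_add_mem hx hy
  rintro v -
  induction v using TensorProduct.induction_on with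
  | zero => exact Submodule.zero_mem _
  | tmul a x =>
    have : TensorProduct.tmul ℤ a x = a • q x := by
      rw [q, TensorProduct.smul_tmul', smul_eq_mul, mul_one]
    rw [this]
    exact Submodule.smul_mem _ _ (key x)
  | add x y hx hy => exact Submodule.add_mem _ hx hy

end Fr


/-- Let `B` be a Noetherian local ring of prime characteristic `p` and dimension `d`,
with perfect residue field and finite Frobenius.  If `T : G₀(B) → G₀(B)` is the Frobenius
pushforward `[M] ↦ [φ_* M]` (restriction of scalars along Frobenius), then the induced
endomorphism of `G₀(B) ⊗ ℚ` is diagonalizable with all eigenvalues among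
`{1, p, p², …, p^d}`. -/
theorem stmt_15 (B : Type) [CommRing B] [IsNoetherianRing B] [IsLocalRing B]
    (p : ℕ) [Fact p.Prime] [CharP B p]
    (hperf : Function.Surjective (fun x : IsLocalRing.ResidueField B => x ^ p))
    (hfrob : (frobenius B p).Finite)
    (d : ℕ) (hd : ringKrullDim B = d)
    (T : G0 B →+ G0 B)
    (hT : ∀ (M N : FGMod B) (e : N.carrier ≃+ M.carrier),
      (∀ (b : B) (x : N.carrier), e (b • x) = frobenius B p b • e x) →
      T (G0.cls M) = G0.cls N) :
    (⨆ j : Fin (d + 1), Module.End.eigenspace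
        (LinearMap.baseChange ℚ T.toIntLinearMap :
          Module.End ℚ (TensorProduct ℤ ℚ (G0 B))) ((p : ℚ) ^ (j : ℕ))) = ⊤ := by
  have hp : p.Prime := Fact.out
  have hfin : Module.Finite B (Fr p B) := hfrob
  have hperf' : ∀ a : B, ∃ b : B, a - b ^ p ∈ IsLocalRing.maximalIdeal B := by
    intro a
    obtain ⟨y, hy⟩ := hperf (IsLocalRing.residue B a)
    obtain ⟨b, rfl⟩ := IsLocalRing.residue_surjective y
    refine ⟨b, ?_⟩
    rw [← IsLocalRing.residue_eq_zero_iff, map_sub, map_pow, sub_eq_zero]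
    exact hy.symm
  have h0 : Fr.W B 0 = ⊥ := by
    rw [Fr.W, Submodule.span_eq_bot]
    rintro v ⟨P, hP, -⟩
    simp at hP
  rw [eq_top_iff, ← Fr.W_top d hd]
  refine Fr.linalg _ p hp.one_lt (Fr.W B) h0 ?_ (d + 1)
  intro i v hv
  induction hv using Submodule.span_induction with
  | zero => simp
  | add x y _ _ hx hy =>
    rw [map_add, smul_add, add_sub_add_comm]
    exact Submodule.add_mem _ hx hy
  | smul a x _ hx =>
    rw [map_smul, smul_comm _ a, ← smul_sub]
    exact Submodule.smul_mem _ _ hx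
  | mem v hv =>
    obtain ⟨P, hP, rfl⟩ := hv
    have hfP : Module.Finite B (Fr p (B ⧸ P.asIdeal)) :=
      Module.Finite.of_surjective (Fr.map p (Submodule.mkQ P.asIdeal)) (Fr.map_surj _ (Submodule.mkQ_surjective _))
    obtain ⟨c, hc⟩ := ENat.ne_top_iff_exists.1 hP.ne_top
    have hci : c < i + 1 := by rw [← hc] at hP; exact_mod_cast hP
    have h1 := Fr.main_step p hperf' P c hc.symm
    have h2 := hT (FGMod.mk (B := B) (B ⧸ P.asIdeal)) (FGMod.mk (B := B) (Fr p (B ⧸ P.asIdeal)))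
      (Fr.outEquiv p _) (fun b x => rfl)
    have h3 : (LinearMap.baseChange ℚ T.toIntLinearMap :
          Module.End ℚ (TensorProduct ℤ ℚ (G0 B))) (Fr.q (G0.cls (FGMod.mk (B := B) (B ⧸ P.asIdeal)))) =
          Fr.q (G0.cls (FGMod.mk (B := B) (Fr p (B ⧸ P.asIdeal)))) := by
      rw [← h2]; rfl
    rw [h3]
    rcases Nat.lt_succ_iff_lt_or_eq.1 hci with h | rfl
    · have hm : Fr.q (G0.cls (FGMod.mk (B := B) (B ⧸ P.asIdeal))) ∈ Fr.W B i :=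
        Submodule.subset_span ⟨P, by rw [← hc]; exact_mod_cast h, rfl⟩
      have h4 := Submodule.add_mem _ (Fr.W_mono B h.le h1) (Submodule.smul_mem _ ((p : ℚ) ^ c) hm)
      rw [sub_add_cancel] at h4
      exact Submodule.sub_mem _ h4 (Submodule.smul_mem _ _ hm)
    · exact h1
end
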